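/- Let φ ∈ BV(S²) ∩ L∞(S²). Then the second moment of the linear statistic of the nodal line of the degree-n random Gaussian spherical harmonic satisfies E[Z^φ(f_n)²] = O(n²·‖φ‖²_{L¹(S²)} + ‖φ‖_∞·‖φ‖_{L¹(S²)}), with a universal implicit constant. In particular, if F ⊆ S² has C² boundary then E[Z^F(f_n)²] = O(n²|F|² + |F|). -/

import Mathlib

noncomputable section

open MeasureTheory ProbabilityTheory Real Filter Asymptotics
open scoped ENNReal NNReal RealInnerProductSpace

/-- Euclidean 3-space. -/
abbrev E3 : Type := EuclideanSpace ℝ (Fin 3)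

/-- The unit 2-sphere `S² ⊂ ℝ³`. -/
abbrev S2 : Type := Metric.sphere (0 : E3) 1

/-- The Legendre polynomial of degree `n`, via Rodrigues' formula
`P_n = 1/(2^n n!) dⁿ/dtⁿ (t² - 1)ⁿ` (the unique degree-`n` polynomial orthogonal on `[-1,1]`
w.r.t. the constant weight, normalized by `P_n(1) = 1`). -/
noncomputable def legendreP (n : ℕ) : Polynomial ℝ :=
  Polynomial.C ((1 : ℝ) / (2 ^ n * n.factorial)) *
    (fun p => Polynomial.derivative p)^[n] ((Polynomial.X ^ 2 - 1) ^ n)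

/-- `P_n(t)`. -/
noncomputable def Pl (n : ℕ) (t : ℝ) : ℝ := (legendreP n).eval t

/-- `P_n′(t)`. -/
noncomputable def Pl' (n : ℕ) (t : ℝ) : ℝ := (Polynomial.derivative (legendreP n)).eval t

/-- `P_n″(t)`. -/
noncomputable def Pl'' (n : ℕ) (t : ℝ) : ℝ :=
  (Polynomial.derivative (Polynomial.derivative (legendreP n))).eval t

/-- The Laplace eigenvalue `E_n = n (n + 1)`. -/
def En (n : ℕ) : ℝ := n * (n + 1)

/-- The surface (Riemannian area) measure on `S²`, realized as the 2-dimensional Hausdorff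
measure. -/
noncomputable def sphArea : Measure S2 := μH[2]

/-- The nodal length of `f : S² → ℝ`: the 1-dimensional Hausdorff measure (length) of the
nodal set `f⁻¹(0)`. -/
noncomputable def nodalLength (f : S2 → ℝ) : ℝ := ((μH[1] : Measure S2) {x | f x = 0}).toReal

/-- The linear statistic `Z^φ(f) = ∫_{f⁻¹(0)} φ(x) dx`: the integral of `φ` along the nodal
line of `f` with respect to arclength. -/
noncomputable def nodalStat (φ : S2 → ℝ) (f : S2 → ℝ) : ℝ :=
  ∫ x in {x : S2 | f x = 0}, φ x ∂(μH[1] : Measure S2)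

/-- The nodal length of `f` inside a subset `F ⊆ S²`: the length of `f⁻¹(0) ∩ F`. -/
noncomputable def nodalLengthIn (F : Set S2) (f : S2 → ℝ) : ℝ :=
  ((μH[1] : Measure S2) ({x | f x = 0} ∩ F)).toReal

/-- `f : Ω → (S² → ℝ)` is a random Gaussian spherical harmonic of degree `n`:
a centered Gaussian random field with continuous sample paths whose covariance function is
`E[f(x) f(y)] = P_n(cos d(x,y)) = P_n(⟨x,y⟩)`. (By the addition theorem, this is precisely
the law of `f_n = √(4π/(2n+1)) ∑_{k=1}^{2n+1} a_k η_k` for an `L²`-orthonormal basis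
`η_1, …, η_{2n+1}` of the degree-`n` spherical-harmonics space `H_n` and i.i.d. standard
Gaussians `a_k`.) -/
def IsRandomSphericalHarmonic {Ω : Type} [MeasureSpace Ω] (n : ℕ) (f : Ω → S2 → ℝ) : Prop :=
  IsProbabilityMeasure (volume : Measure Ω) ∧
  (∀ ω, Continuous (f ω)) ∧
  (∀ (k : ℕ) (x : Fin k → S2) (c : Fin k → ℝ), ∃ v : ℝ≥0,
      Measure.map (fun ω => ∑ i, c i * f ω (x i)) volume = gaussianReal 0 v) ∧
  (∀ x y : S2, (∫ ω, f ω x * f ω y) = Pl n ⟪(x : E3), (y : E3)⟫)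

/-- The tangential (surface) divergence on `S²` of a vector field `g : ℝ³ → ℝ³`:
`div_{S²} g (x) = tr(Dg(x)) - ⟨Dg(x) x, x⟩`, the trace of the derivative of `g`
restricted to the tangent plane `T_x S²`. -/
noncomputable def sDiv (g : E3 → E3) (x : S2) : ℝ :=
  (∑ i : Fin 3,
      ⟪fderiv ℝ g (x : E3) (EuclideanSpace.single i (1 : ℝ)), EuclideanSpace.single i (1 : ℝ)⟫)
    - ⟪fderiv ℝ g (x : E3) (x : E3), (x : E3)⟫

/-- A `C¹` vector field on `S²` (realized as a `C¹` field on `ℝ³` which is tangent to the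
sphere) with `|g| ≤ 1` pointwise on the sphere. -/
def IsUnitTangentField (g : E3 → E3) : Prop :=
  ContDiff ℝ 1 g ∧ (∀ x : S2, ⟪g (x : E3), (x : E3)⟫ = 0) ∧ (∀ x : S2, ‖g (x : E3)‖ ≤ 1)

/-- The set of numbers `∫_{S²} φ · div g`, over all `C¹` unit tangent vector fields `g`;
its supremum is the total variation `V(φ)`. -/
noncomputable def varSet (φ : S2 → ℝ) : Set ℝ :=
  {v | ∃ g : E3 → E3, IsUnitTangentField g ∧ v = ∫ x, φ x * sDiv g x ∂sphArea}

/-- `φ ∈ BV(S²)`: `φ` is integrable and has finite total variation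
`V(φ) = sup { ∫_{S²} φ div g : g C¹ tangent vector field, |g| ≤ 1 }`. -/
def IsBV (φ : S2 → ℝ) : Prop := Integrable φ sphArea ∧ BddAbove (varSet φ)

/-- The total variation `V(φ)` of `φ : S² → ℝ`. -/
noncomputable def totVar (φ : S2 → ℝ) : ℝ := sSup (varSet φ)

/-- The tangential gradient on `S²` of a function `Φ : ℝ³ → ℝ`:
`∇_{S²}Φ(x) = ∇Φ(x) - ⟨∇Φ(x), x⟩ x`. -/
noncomputable def tGrad (Φ : E3 → ℝ) (x : S2) : E3 :=
  gradient Φ (x : E3) - ⟪gradient Φ (x : E3), (x : E3)⟫ • (x : E3)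

/-- The total variation `V(φ) = ∫_{S²} ‖∇_{S²} φ(x)‖ dx` of the `C¹` function on `S²`
obtained by restricting `Φ : ℝ³ → ℝ` to the sphere. -/
noncomputable def c1Var (Φ : E3 → ℝ) : ℝ := ∫ x, ‖tGrad Φ x‖ ∂sphArea

/-- `F ⊆ S²` is a subsurface with `C²` boundary: `F` is cut out on the sphere as
`{Φ ≤ 0}` by a `C²` function `Φ : ℝ³ → ℝ` having `0` as a regular value of its restriction
to the sphere (the tangential derivative of `Φ` is nonzero at every boundary point). -/
def IsC2Domain (F : Set S2) : Prop :=
  ∃ Φ : E3 → ℝ, ContDiff ℝ 2 Φ ∧ (∀ x : S2, x ∈ F ↔ Φ (x : E3) ≤ 0) ∧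
    ∀ x : S2, Φ (x : E3) = 0 →
      ∃ v : E3, ⟪v, (x : E3)⟫ = 0 ∧ fderiv ℝ Φ (x : E3) v ≠ 0

/-! ### Legendre polynomials -/

section Legendre
open Polynomial

lemma iter_der_X_mul (k : ℕ) (p : ℝ[X]) :
    derivative^[k+1] (X * p) = X * derivative^[k+1] p + ((k : ℝ[X]) + 1) * derivative^[k] p := by
  induction k with
  | zero => simp [derivative_mul]; ring
  | succ k ih =>
    rw [Function.iterate_succ_apply', ih, Function.iterate_succ_apply' _ (k+1),
      Function.iterate_succ_apply' _ k]
    simp only [derivative_mul, derivative_add, derivative_X, derivative_natCast, derivative_one]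
    push_cast
    ring

lemma iter_der_quad_mul (k : ℕ) (q : ℝ[X]) :
    derivative^[k+1] ((X^2 - 1) * derivative q) = (X^2 - 1) * derivative^[k+2] q
      + 2 * ((k : ℝ[X]) + 1) * X * derivative^[k+1] q
      + (k : ℝ[X]) * ((k : ℝ[X]) + 1) * derivative^[k] q := by
  induction k with
  | zero => simp [derivative_mul]; ring
  | succ k ih =>
    rw [Function.iterate_succ_apply', ih, Function.iterate_succ_apply' _ (k+2),
      Function.iterate_succ_apply' _ (k+1), Function.iterate_succ_apply' _ k]
    simp only [derivative_mul, derivative_add, derivative_sub, derivative_X, derivative_natCast,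
      derivative_one, derivative_X_pow, derivative_ofNat]
    push_cast
    simp only [C_ofNat]
    ring

lemma legendre_ode_poly (n : ℕ) :
    (X^2 - 1) * derivative (derivative (legendreP n)) + 2 * X * derivative (legendreP n)
      = (n : ℝ[X]) * ((n : ℝ[X]) + 1) * legendreP n := by
  set u : ℝ[X] := (X^2 - 1)^n with hu
  have h1 : (X^2 - 1) * derivative u = (n : ℝ[X]) * (2 * (X * u)) := by
    rcases n with _ | n
    · simp [hu]
    · rw [hu, derivative_pow_succ]
      simp only [derivative_sub, derivative_X_pow, derivative_one]
      simp only [Nat.cast_ofNat, C_ofNat]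
      push_cast
      simp
      ring
  have h2 := congrArg (fun p => derivative^[n+1] p) h1
  beta_reduce at h2
  rw [iter_der_quad_mul] at h2
  have h3 : derivative^[n+1] ((n : ℝ[X]) * (2 * (X * u)))
      = (n : ℝ[X]) * (2 * derivative^[n+1] (X * u)) := by
    rw [iterate_derivative_natCast_mul]
    congr 1
    exact_mod_cast iterate_derivative_natCast_mul (n := 2)
  rw [h3, iter_der_X_mul] at h2
  have e0 : legendreP n = C ((1 : ℝ) / (2 ^ n * n.factorial)) * derivative^[n] u := rfl
  have e1 : derivative (legendreP n) = C ((1 : ℝ) / (2 ^ n * n.factorial)) * derivative^[n+1] u := by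
    rw [e0, derivative_C_mul, Function.iterate_succ_apply']
  have e2 : derivative (derivative (legendreP n))
      = C ((1 : ℝ) / (2 ^ n * n.factorial)) * derivative^[n+2] u := by
    rw [e1, derivative_C_mul, Function.iterate_succ_apply' _ (n+1)]
  rw [e2, e1, e0]
  linear_combination C ((1 : ℝ) / (2 ^ n * n.factorial)) * h2

lemma Pl_one (n : ℕ) : Pl n 1 = 1 := by
  have hu : ((X : ℝ[X])^2 - 1)^n = (X - C 1)^n * (X + C 1)^n := by
    rw [← mul_pow]; congr 1; simp; ring
  unfold Pl legendreP
  have h : (((derivative (R := ℝ))^[n] (((X : ℝ[X])^2 - 1)^n)).eval 1) = 2^n * n.factorial := by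
    rw [hu, iterate_derivative_mul, eval_finsetSum, Finset.sum_eq_single_of_mem 0 (by simp)]
    · rw [Nat.sub_zero, iterate_derivative_X_sub_pow_self]
      simp [one_add_one_eq_two]
      ring
    · intro k hk hk0
      have : k ≤ n := by simpa [Nat.lt_succ_iff] using hk
      rw [iterate_derivative_X_sub_pow]
      simp
      right; left
      omega
  change eval 1 (C _ * (derivative (R := ℝ))^[n] _) = 1
  rw [eval_mul, h, eval_C]
  have : (n.factorial : ℝ) ≠ 0 := by exact_mod_cast n.factorial_ne_zero
  field_simp

lemma hasDerivAt_Pl (n : ℕ) (t : ℝ) : HasDerivAt (Pl n) (Pl' n t) t :=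
  (legendreP n).hasDerivAt t

lemma hasDerivAt_Pl' (n : ℕ) (t : ℝ) : HasDerivAt (Pl' n) (Pl'' n t) t :=
  (derivative (legendreP n)).hasDerivAt t

lemma legendre_ode (n : ℕ) (t : ℝ) :
    (t^2 - 1) * Pl'' n t + 2 * t * Pl' n t = En n * Pl n t := by
  have := congrArg (eval t) (legendre_ode_poly n)
  simpa [Pl, Pl', Pl'', En] using this

lemma En_ge_two {n : ℕ} (hn : 1 ≤ n) : 2 ≤ En n := by
  have : (1 : ℝ) ≤ n := by exact_mod_cast hn
  unfold En; nlinarith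

/-- energy -/
def lG (n : ℕ) (t : ℝ) : ℝ := Pl n t ^ 2 + (1 - t^2) * Pl' n t ^ 2 / En n

lemma hasDerivAt_lG {n : ℕ} (hn : 1 ≤ n) (t : ℝ) :
    HasDerivAt (lG n) (2 * t * Pl' n t ^ 2 / En n) t := by
  have h0 : En n ≠ 0 := by have := En_ge_two hn; linarith
  have h := ((hasDerivAt_Pl n t).pow 2).add
    (((((hasDerivAt_id t).pow 2).const_sub 1).mul ((hasDerivAt_Pl' n t).pow 2)).div_const (En n))
  refine h.congr_deriv ?_
  have ode := legendre_ode n t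
  simp
  field_simp
  linear_combination (-1 * Pl' n t) * ode

lemma lG_one (n : ℕ) : lG n 1 = 1 := by simp [lG, Pl_one]

lemma lG_mono {n : ℕ} (hn : 1 ≤ n) : MonotoneOn (lG n) (Set.Icc 0 1) := by
  have h0 := En_ge_two hn
  refine monotoneOn_of_hasDerivWithinAt_nonneg (convex_Icc 0 1)
    (fun x _ => (hasDerivAt_lG hn x).continuousAt.continuousWithinAt)
    (fun x _ => (hasDerivAt_lG hn x).hasDerivWithinAt) ?_
  intro x hx
  rw [interior_Icc] at hx
  have := hx.1.le
  positivity

lemma Pl_sq_le_lG {n : ℕ} (hn : 1 ≤ n) {t : ℝ} (ht : t ∈ Set.Icc (0:ℝ) 1) :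
    Pl n t ^ 2 ≤ lG n t := by
  have h0 := En_ge_two hn
  have : 0 ≤ 1 - t^2 := by nlinarith [ht.1, ht.2]
  have : 0 ≤ (1 - t^2) * Pl' n t ^ 2 / En n := by positivity
  unfold lG; linarith

lemma Pl_sq_le_one {n : ℕ} (hn : 1 ≤ n) {t : ℝ} (ht : t ∈ Set.Icc (0:ℝ) 1) :
    Pl n t ^ 2 ≤ 1 := by
  have := lG_mono hn ht (Set.right_mem_Icc.2 zero_le_one) ht.2
  rw [lG_one] at this
  exact (Pl_sq_le_lG hn ht).trans this

lemma hasDerivAt_lW (n : ℕ) (t : ℝ) :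
    HasDerivAt (fun t => (1 - t^2) * Pl' n t) (- (En n * Pl n t)) t := by
  have h := (((hasDerivAt_id t).pow 2).const_sub 1).mul (hasDerivAt_Pl' n t)
  refine h.congr_deriv ?_
  have ode := legendre_ode n t
  simp
  linear_combination (-1) * ode

lemma Pl'_le {n : ℕ} (hn : 1 ≤ n) {t : ℝ} (h0 : 0 ≤ t) (h1 : t < 1) : Pl' n t ≤ En n := by
  have hE := En_ge_two hn
  have hm : MonotoneOn (fun t => (1 - t^2) * Pl' n t + En n * t) (Set.Icc 0 1) := by
    have hd : ∀ x, HasDerivAt (fun t => (1 - t^2) * Pl' n t + En n * t)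
        (- (En n * Pl n x) + En n * 1) x := fun x =>
      (hasDerivAt_lW n x).add ((hasDerivAt_id x).const_mul (En n))
    refine monotoneOn_of_hasDerivWithinAt_nonneg (convex_Icc 0 1)
      (fun x _ => (hd x).continuousAt.continuousWithinAt)
      (fun x _ => (hd x).hasDerivWithinAt) ?_
    intro x hx
    rw [interior_Icc] at hx
    have := Pl_sq_le_one hn (Set.Ioo_subset_Icc_self hx)
    have : Pl n x ≤ 1 := by nlinarith
    nlinarith
  have := hm ⟨h0, h1.le⟩ (Set.right_mem_Icc.2 zero_le_one) h1.le
  simp only at this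
  have h2 : (1 - t) * ((1 + t) * Pl' n t) ≤ (1 - t) * En n := by nlinarith
  have h3 := le_of_mul_le_mul_left h2 (by linarith)
  by_contra hc
  push Not at hc
  nlinarith

lemma one_sub_Pl_le {n : ℕ} (hn : 1 ≤ n) {t : ℝ} (ht : t ∈ Set.Icc (0:ℝ) 1) :
    1 - Pl n t ≤ En n * (1 - t) := by
  have hm : MonotoneOn (fun t => En n * t - Pl n t) (Set.Icc 0 1) := by
    have hd : ∀ x, HasDerivAt (fun t => En n * t - Pl n t) (En n * 1 - Pl' n x) x := fun x =>
      ((hasDerivAt_id x).const_mul (En n)).sub (hasDerivAt_Pl n x)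
    refine monotoneOn_of_hasDerivWithinAt_nonneg (convex_Icc 0 1)
      (fun x _ => (hd x).continuousAt.continuousWithinAt)
      (fun x _ => (hd x).hasDerivWithinAt) ?_
    intro x hx
    rw [interior_Icc] at hx
    have := Pl'_le hn hx.1.le hx.2
    linarith
  have := hm ht (Set.right_mem_Icc.2 zero_le_one) ht.2
  simp only [Pl_one] at this
  linarith

lemma Pl'_ge {n : ℕ} (hn : 1 ≤ n) {t : ℝ} (h0 : 1 - t ≤ 1 / (2 * En n)) (h1 : t < 1) :
    En n / 4 ≤ Pl' n t := by
  have hE := En_ge_two hn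
  have hhalf : 1 / (2 * En n) ≤ 1/4 := by
    rw [div_le_div_iff₀ (by positivity) (by positivity)]; linarith
  have ht0 : 0 ≤ t := by linarith
  have hP : ∀ s ∈ Set.Icc t 1, 1/2 ≤ Pl n s := by
    intro s hs
    have := one_sub_Pl_le hn (t := s) ⟨by linarith [hs.1], hs.2⟩
    have h2 : En n * (1 - s) ≤ En n * (1 / (2 * En n)) :=
      mul_le_mul_of_nonneg_left (by linarith [hs.1]) (by linarith)
    have h3 : En n * (1 / (2 * En n)) = 1/2 := by field_simp
    linarith
  have hm : AntitoneOn (fun t => (1 - t^2) * Pl' n t + En n / 2 * t) (Set.Icc t 1) := by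
    have hd : ∀ x, HasDerivAt (fun t => (1 - t^2) * Pl' n t + En n / 2 * t)
        (- (En n * Pl n x) + En n / 2 * 1) x := fun x =>
      (hasDerivAt_lW n x).add ((hasDerivAt_id x).const_mul (En n / 2))
    refine antitoneOn_of_hasDerivWithinAt_nonpos (convex_Icc t 1)
      (fun x _ => (hd x).continuousAt.continuousWithinAt)
      (fun x _ => (hd x).hasDerivWithinAt) ?_
    intro x hx
    rw [interior_Icc] at hx
    have := hP x (Set.Ioo_subset_Icc_self hx)
    nlinarith
  have := hm (Set.left_mem_Icc.2 h1.le) (Set.right_mem_Icc.2 h1.le) h1.le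
  simp only at this
  have h2 : (1 - t) * (En n / 2) ≤ (1 - t) * ((1 + t) * Pl' n t) := by nlinarith
  have h3 := le_of_mul_le_mul_left h2 (by linarith)
  by_contra hc
  push Not at hc
  nlinarith

lemma lG_le_near {n : ℕ} (hn : 1 ≤ n) {t : ℝ} (h0 : 1 - t ≤ 1 / (2 * En n)) (h1 : t ≤ 1) :
    lG n t ≤ 1 - En n / 16 * (1 - t) := by
  have hE := En_ge_two hn
  have hhalf : 1 / (2 * En n) ≤ 1/4 := by
    rw [div_le_div_iff₀ (by positivity) (by positivity)]; linarith
  have hm : MonotoneOn (fun t => lG n t - En n / 16 * t) (Set.Icc t 1) := by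
    have hd : ∀ x, HasDerivAt (fun t => lG n t - En n / 16 * t)
        (2 * x * Pl' n x ^ 2 / En n - En n / 16 * 1) x := fun x =>
      (hasDerivAt_lG hn x).sub ((hasDerivAt_id x).const_mul (En n / 16))
    refine monotoneOn_of_hasDerivWithinAt_nonneg (convex_Icc t 1)
      (fun x _ => (hd x).continuousAt.continuousWithinAt)
      (fun x _ => (hd x).hasDerivWithinAt) ?_
    intro x hx
    rw [interior_Icc] at hx
    have h4 := Pl'_ge hn (t := x) (by linarith [hx.1]) hx.2
    have h5 : (En n / 4)^2 ≤ Pl' n x ^ 2 := by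
      apply pow_le_pow_left₀ (by linarith) h4
    have h6 : En n / 16 ≤ 2 * x * Pl' n x ^ 2 / En n := by
      rw [le_div_iff₀ (by linarith)]
      have : (1:ℝ) ≤ 2 * x := by linarith [hx.1]
      nlinarith
    linarith
  have := hm (Set.left_mem_Icc.2 h1) (Set.right_mem_Icc.2 h1) h1
  simp only [lG_one] at this
  linarith

lemma one_sub_Pl_sq_ge {n : ℕ} (hn : 1 ≤ n) {t : ℝ} (ht : t ∈ Set.Icc (0:ℝ) 1) :
    1/32 * min 1 (En n * (1 - t)) ≤ 1 - Pl n t ^ 2 := by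
  have hE := En_ge_two hn
  have hhalf : 1 / (2 * En n) ≤ 1/4 := by
    rw [div_le_div_iff₀ (by positivity) (by positivity)]; linarith
  have hG := Pl_sq_le_lG hn ht
  rcases le_total (1 - t) (1 / (2 * En n)) with h | h
  · have h1 := lG_le_near hn h ht.2
    have h2 := min_le_right 1 (En n * (1 - t))
    have : 0 ≤ En n * (1 - t) := mul_nonneg (by linarith) (by linarith [ht.2])
    linarith
  · have hpos : 0 ≤ 1 / (2 * En n) := by positivity
    have h1 := lG_le_near hn (t := 1 - 1 / (2 * En n)) (by linarith) (by linarith)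
    have h2 := lG_mono hn ht (b := 1 - 1 / (2 * En n)) ⟨by linarith, by linarith⟩ (by linarith)
    have h3 := min_le_left 1 (En n * (1 - t))
    have h4 : En n / 16 * (1 - (1 - 1 / (2 * En n))) = 1/32 := by field_simp; ring
    linarith

end Legendre

/-! ### Gaussian small-ball estimates -/

section Gaussian

set_option linter.unusedSectionVars false

variable {E : Type*} [NormedAddCommGroup E] [InnerProductSpace ℝ E] [FiniteDimensional ℝ E]
  [MeasurableSpace E] [BorelSpace E]

/-- projection orthogonal to `a` (for unit `a`). -/
def pr (a : E) : E →L[ℝ] E := ContinuousLinearMap.id ℝ E - (innerSL ℝ a).smulRight a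

lemma pr_apply (a x : E) : pr a x = x - ⟪a, x⟫ • a := by simp [pr]

lemma inner_pr (a x y : E) : ⟪pr a x, y⟫ = ⟪x, pr a y⟫ := by
  simp only [pr_apply, inner_sub_left, inner_sub_right, real_inner_smul_left, real_inner_smul_right]
  rw [real_inner_comm x a]; ring

lemma norm_pr_sq {a : E} (ha : ‖a‖ = 1) (x : E) : ‖pr a x‖^2 = ‖x‖^2 - ⟪a, x⟫^2 := by
  rw [pr_apply, norm_sub_sq_real, real_inner_smul_right, norm_smul, ha, real_inner_comm]
  simp
  ring

lemma gaussian_decomp {a : E} (ha : ‖a‖ = 1) :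
    stdGaussian E = ((stdGaussian E).map (pr a)) ∗ ((gaussianReal 0 1).map (fun s : ℝ => s • a)) := by
  have : IsProbabilityMeasure ((stdGaussian E).map (pr a)) :=
    Measure.isProbabilityMeasure_map (pr a).continuous.aemeasurable
  have : IsProbabilityMeasure ((gaussianReal 0 1).map (fun s : ℝ => s • a)) :=
    Measure.isProbabilityMeasure_map (by fun_prop)
  apply Measure.ext_of_charFun
  ext t
  rw [charFun_conv, charFun_stdGaussian]
  have h1 : charFun ((stdGaussian E).map (pr a)) t = charFun (stdGaussian E) (pr a t) := by
    rw [charFun_apply, charFun_apply, integral_map (pr a).continuous.aemeasurable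
      (by fun_prop)]
    simp_rw [inner_pr]
  have h2 : charFun ((gaussianReal 0 1).map (fun s : ℝ => s • a)) t
      = charFun (gaussianReal 0 1) ⟪a, t⟫ := by
    rw [charFun_apply, charFun_apply_real, integral_map (by fun_prop) (by fun_prop)]
    simp_rw [real_inner_smul_left]
    congr 1; ext x; push_cast; ring_nf
  rw [h1, h2, charFun_stdGaussian, charFun_gaussianReal, ← Complex.exp_add]
  congr 1
  have := norm_pr_sq ha t
  have h3 : ((‖pr a t‖ : ℂ))^2 = (‖t‖:ℂ)^2 - (⟪a, t⟫:ℂ)^2 := by exact_mod_cast this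
  rw [h3]
  simp
  ring

lemma lintegral_decomp {a : E} (ha : ‖a‖ = 1) {F : E → ℝ≥0∞} (hF : Measurable F) :
    ∫⁻ x, F x ∂(stdGaussian E)
      = ∫⁻ y, ∫⁻ s, F (pr a y + s • a) ∂(gaussianReal 0 1) ∂(stdGaussian E) := by
  conv_lhs => rw [gaussian_decomp ha]
  have : IsProbabilityMeasure ((stdGaussian E).map (pr a)) :=
    Measure.isProbabilityMeasure_map (pr a).continuous.aemeasurable
  have : IsProbabilityMeasure ((gaussianReal 0 1).map (fun s : ℝ => s • a)) :=
    Measure.isProbabilityMeasure_map (by fun_prop)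
  have hm : Measurable fun y => ∫⁻ x, F (y + x) ∂((gaussianReal 0 1).map (fun s : ℝ => s • a)) :=
    Measurable.lintegral_prod_right' (f := fun p : E × E => F (p.1 + p.2)) (by fun_prop)
  rw [Measure.lintegral_conv hF, lintegral_map hm (pr a).continuous.measurable]
  congr 1; ext y
  rw [lintegral_map (by fun_prop) (by fun_prop)]

lemma gaussianReal_Icc_le (c r : ℝ) :
    gaussianReal 0 1 (Set.Icc c (c + 2 * r)) ≤ ENNReal.ofReal r := by
  rw [gaussianReal_apply 0 one_ne_zero]
  calc ∫⁻ x in Set.Icc c (c + 2 * r), gaussianPDF 0 1 x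
      ≤ ∫⁻ x in Set.Icc c (c + 2 * r), ENNReal.ofReal (1/2) := by
        apply lintegral_mono
        intro x
        apply ENNReal.ofReal_le_ofReal
        rw [gaussianPDFReal]
        have h1 : rexp (-(x - 0) ^ 2 / (2 * ((1:ℝ≥0):ℝ))) ≤ 1 := by
          rw [Real.exp_le_one_iff]
          apply div_nonpos_of_nonpos_of_nonneg
          · nlinarith [sq_nonneg (x - 0)]
          · positivity
        have h2 : (√(2 * π * ((1:ℝ≥0):ℝ)))⁻¹ ≤ 1/2 := by
          rw [inv_le_comm₀ (by positivity) (by norm_num)]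
          apply Real.le_sqrt_of_sq_le
          have := Real.pi_gt_three
          norm_num
          linarith
        calc _ ≤ (1/2 : ℝ) * 1 := mul_le_mul h2 h1 (Real.exp_pos _).le (by norm_num)
          _ = 1/2 := by norm_num
    _ = ENNReal.ofReal r := by
        rw [lintegral_const, Measure.restrict_apply_univ, Real.volume_Icc,
          ← ENNReal.ofReal_mul (by norm_num)]
        congr 1; ring

lemma lintegral_seminorm_pr_le (p : Seminorm ℝ E) (hp : Continuous p) {a : E} (ha : ‖a‖ = 1) :
    ∫⁻ x, ENNReal.ofReal (p (pr a x) ^ 2) ∂(stdGaussian E)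
      ≤ ∫⁻ x, ENNReal.ofReal (p x ^ 2) ∂(stdGaussian E) := by
  rw [lintegral_decomp ha (F := fun x => ENNReal.ofReal (p x ^ 2)) (by fun_prop)]
  apply lintegral_mono
  intro y
  have key : ∀ s : ℝ, ENNReal.ofReal (p (pr a y) ^ 2) ≤
      ENNReal.ofReal (1/2) * (ENNReal.ofReal (p (pr a y + s • a) ^ 2)
       + ENNReal.ofReal (p (pr a y + (-s) • a) ^ 2)) := by
    intro s
    rw [← ENNReal.ofReal_add (by positivity) (by positivity), ← ENNReal.ofReal_mul (by norm_num)]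
    apply ENNReal.ofReal_le_ofReal
    have h1 : p ((2:ℝ) • pr a y) ≤ p (pr a y + s • a) + p (pr a y + (-s) • a) := by
      refine le_trans (le_of_eq ?_) (map_add_le_add p _ _)
      congr 1; module
    rw [map_smul_eq_mul] at h1
    rw [show ‖(2:ℝ)‖ = 2 by norm_num] at h1
    have := apply_nonneg p (pr a y)
    nlinarith [sq_nonneg (p (pr a y + s • a) - p (pr a y + (-s) • a))]
  have hsymm : ∫⁻ s, ENNReal.ofReal (p (pr a y + (-s) • a) ^ 2) ∂(gaussianReal 0 1)
      = ∫⁻ s, ENNReal.ofReal (p (pr a y + s • a) ^ 2) ∂(gaussianReal 0 1) := by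
    have := gaussianReal_map_neg (μ := 0) (v := 1)
    rw [neg_zero] at this
    conv_rhs => rw [← this]
    rw [lintegral_map (by fun_prop) (by fun_prop)]
  calc ENNReal.ofReal (p (pr a y) ^ 2)
      = ∫⁻ s, ENNReal.ofReal (p (pr a y) ^ 2) ∂(gaussianReal 0 1) := by simp
    _ ≤ ∫⁻ s, ENNReal.ofReal (1/2) * (ENNReal.ofReal (p (pr a y + s • a) ^ 2)
       + ENNReal.ofReal (p (pr a y + (-s) • a) ^ 2)) ∂(gaussianReal 0 1) := lintegral_mono key
    _ = ∫⁻ s, ENNReal.ofReal (p (pr a y + s • a) ^ 2) ∂(gaussianReal 0 1) := by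
      rw [lintegral_const_mul _ (by fun_prop), lintegral_add_left (by fun_prop), hsymm, ← two_mul,
        ← mul_assoc]
      have : ENNReal.ofReal (1/2) * 2 = 1 := by
        rw [show (2:ℝ≥0∞) = ENNReal.ofReal 2 by simp, ← ENNReal.ofReal_mul (by norm_num)]
        norm_num
      rw [this, one_mul]

lemma inner_pr_self {a : E} (ha : ‖a‖ = 1) (x : E) : ⟪a, pr a x⟫ = 0 := by
  rw [pr_apply, inner_sub_right, real_inner_smul_right, real_inner_self_eq_norm_sq, ha]; ring

lemma one_point (p : Seminorm ℝ E) (hp : Continuous p) {B ε : ℝ} (hB : 0 < B) (hε : 0 ≤ ε)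
    (hpB : ∀ v, p v ≤ B * ‖v‖)
    (hp2 : ∫⁻ x, ENNReal.ofReal (p x ^ 2) ∂(stdGaussian E) ≤ ENNReal.ofReal (B ^ 2))
    {a : E} (ha : ‖a‖ = 1) (hεB : 2 * ε * B ≤ 1) :
    stdGaussian E {x | |⟪a, x⟫| ≤ ε * p x} ≤ ENNReal.ofReal (2 * ε * B) := by
  have hmeas : MeasurableSet {x | |⟪a, x⟫| ≤ ε * p x} :=
    measurableSet_le (by fun_prop) (by fun_prop)
  rw [← lintegral_indicator_one hmeas, lintegral_decomp ha (measurable_one.indicator hmeas)]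
  have key : ∀ y, ∫⁻ s, Set.indicator {x | |⟪a, x⟫| ≤ ε * p x} (1 : E → ℝ≥0∞) (pr a y + s • a)
        ∂(gaussianReal 0 1) ≤ ENNReal.ofReal (2 * ε * p (pr a y)) := by
    intro y
    set r := 2 * ε * p (pr a y) with hr
    refine le_trans ?_ (gaussianReal_Icc_le (-r) r)
    rw [← lintegral_indicator_one measurableSet_Icc]
    apply lintegral_mono
    intro s
    simp only
    by_cases hs : pr a y + s • a ∈ {x | |⟪a, x⟫| ≤ ε * p x}
    · have hs' : s ∈ Set.Icc (-r) (-r + 2 * r) := by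
        simp only [Set.mem_ofPred_eq, inner_add_right, inner_pr_self ha, real_inner_smul_right,
          real_inner_self_eq_norm_sq, ha] at hs
        norm_num at hs
        have h1 : p (pr a y + s • a) ≤ p (pr a y) + |s| * B := by
          refine (map_add_le_add p _ _).trans ?_
          rw [map_smul_eq_mul]
          have := hpB a
          rw [ha] at this
          simp only [Real.norm_eq_abs]
          gcongr; linarith
        have h2 : |s| ≤ ε * (p (pr a y) + |s| * B) := hs.trans (by gcongr)
        have h3 : |s| ≤ r := by
          have := abs_nonneg s
          nlinarith
        rw [abs_le] at h3
        exact ⟨h3.1, by linarith [h3.2]⟩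
      rw [Set.indicator_of_mem hs, Set.indicator_of_mem hs']
      simp
    · rw [Set.indicator_of_notMem hs]; exact zero_le
  calc _ ≤ ∫⁻ y, ENNReal.ofReal (2 * ε * p (pr a y)) ∂(stdGaussian E) := lintegral_mono key
    _ ≤ ∫⁻ y, (ENNReal.ofReal (ε / B) * ENNReal.ofReal (p (pr a y) ^ 2) + ENNReal.ofReal (ε * B))
          ∂(stdGaussian E) := by
        apply lintegral_mono
        intro y
        simp only
        rw [← ENNReal.ofReal_mul (by positivity), ← ENNReal.ofReal_add (by positivity) (by positivity)]
        apply ENNReal.ofReal_le_ofReal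
        have : ε / B * p (pr a y) ^ 2 + ε * B - 2 * ε * p (pr a y)
            = ε / B * (p (pr a y) - B)^2 := by field_simp; ring
        have : 0 ≤ ε / B * (p (pr a y) - B)^2 := by positivity
        linarith
    _ ≤ ENNReal.ofReal (ε / B) * ENNReal.ofReal (B ^ 2) + ENNReal.ofReal (ε * B) := by
        rw [lintegral_add_right _ (by fun_prop), lintegral_const_mul _ (by fun_prop)]
        simp only [lintegral_const, measure_univ, mul_one]
        gcongr
        exact (lintegral_seminorm_pr_le p hp ha).trans hp2
    _ = ENNReal.ofReal (2 * ε * B) := by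
        rw [← ENNReal.ofReal_mul (by positivity), ← ENNReal.ofReal_add (by positivity) (by positivity)]
        congr 1; field_simp; ring

lemma two_point (p : Seminorm ℝ E) (hp : Continuous p) {B ε σ : ℝ} (hB : 0 < B) (hε : 0 ≤ ε)
    (hpB : ∀ v, p v ≤ B * ‖v‖)
    (hp2 : ∫⁻ x, ENNReal.ofReal (p x ^ 2) ∂(stdGaussian E) ≤ ENNReal.ofReal (B ^ 2))
    {a b : E} (ha : ‖a‖ = 1) (hb : ‖b‖ = 1) (hσ : 0 < σ) (hσ2 : σ ^ 2 = 1 - ⟪a, b⟫ ^ 2)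
    (hεB : 8 * ε * B ≤ σ) :
    stdGaussian E {x | |⟪a, x⟫| ≤ ε * p x ∧ |⟪b, x⟫| ≤ ε * p x}
      ≤ ENNReal.ofReal (16 * ε ^ 2 * B ^ 2 / σ) := by
  set ρ := ⟪a, b⟫ with hρ
  obtain ⟨b', hb'def⟩ : ∃ b', b' = σ⁻¹ • (b - ρ • a) := ⟨_, rfl⟩
  have hbb : b = ρ • a + σ • b' := by
    rw [hb'def, smul_inv_smul₀ hσ.ne']; abel
  have hab' : ⟪a, b'⟫ = 0 := by
    rw [hb'def, real_inner_smul_right, inner_sub_right, real_inner_smul_right,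
      real_inner_self_eq_norm_sq, ha, ← hρ]; ring
  have hb' : ‖b'‖ = 1 := by
    have h1 : ‖b - ρ • a‖^2 = σ^2 := by
      rw [norm_sub_sq_real, real_inner_smul_right, norm_smul, ha, hb, real_inner_comm, ← hρ, hσ2]
      simp; ring
    have h2 : ‖b - ρ • a‖ = σ := by
      rw [← abs_of_pos hσ, ← abs_of_nonneg (norm_nonneg _)]; exact (sq_eq_sq_iff_abs_eq_abs _ _).1 h1
    rw [hb'def, norm_smul, h2, Real.norm_eq_abs, abs_inv, abs_of_pos hσ, inv_mul_cancel₀ hσ.ne']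
  have hρ1 : |ρ| ≤ 1 := by rw [← sq_le_one_iff_abs_le_one]; nlinarith
  have hσ1 : σ ≤ 1 := by nlinarith [sq_nonneg ρ]
  set S := {x : E | |⟪a, x⟫| ≤ ε * p x ∧ |⟪b, x⟫| ≤ ε * p x} with hS
  have hmeas : MeasurableSet S :=
    (measurableSet_le (f := fun x => |⟪a, x⟫|) (g := fun x => ε * p x)
      (by fun_prop) (by fun_prop)).inter
      (measurableSet_le (f := fun x => |⟪b, x⟫|) (g := fun x => ε * p x)
      (by fun_prop) (by fun_prop))
  set q : E → ℝ := fun y => p (pr b' (pr a y)) with hq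
  have hR : ∀ (y : E) (s t : ℝ), pr b' (pr a y + s • a) + t • b' = pr b' (pr a y) + s • a + t • b' := by
    intro y s t
    have : pr b' a = a := by rw [pr_apply, real_inner_comm, hab']; simp
    rw [map_add, map_smul, this]
  have hcore : ∀ (y : E) (s t : ℝ), pr b' (pr a y + s • a) + t • b' ∈ S →
      |s| ≤ 4 * ε * q y ∧ |ρ * s + σ * t| ≤ 4 * ε * q y := by
    intro y s t hx
    rw [hR] at hx
    set x := pr b' (pr a y) + s • a + t • b' with hxdef
    have e1 : ⟪a, x⟫ = s := by
      rw [hxdef, inner_add_right, inner_add_right, real_inner_smul_right, real_inner_smul_right,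
        hab', real_inner_self_eq_norm_sq, ha, ← inner_pr]
      have : pr b' a = a := by rw [pr_apply, real_inner_comm, hab']; simp
      rw [this, inner_pr_self ha]; ring
    have e2 : ⟪b', x⟫ = t := by
      rw [hxdef, inner_add_right, inner_add_right, real_inner_smul_right, real_inner_smul_right,
        real_inner_comm a b', hab', real_inner_self_eq_norm_sq, hb', inner_pr_self hb']
      ring
    have e3 : ⟪b, x⟫ = ρ * s + σ * t := by
      rw [hbb, inner_add_left, real_inner_smul_left, real_inner_smul_left, e1, e2]
    obtain ⟨h1, h2⟩ := hx
    rw [e1] at h1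
    rw [e3] at h2
    set w := ρ * s + σ * t with hw
    have hpx : p x ≤ q y + |s| * B + |t| * B := by
      refine (map_add_le_add p _ _).trans (add_le_add ((map_add_le_add p _ _).trans ?_) ?_)
      · rw [map_smul_eq_mul]
        have := hpB a
        rw [ha] at this
        simp only [Real.norm_eq_abs]
        gcongr; linarith
      · rw [map_smul_eq_mul]
        have := hpB b'
        rw [hb'] at this
        simp only [Real.norm_eq_abs]
        gcongr; linarith
    have ht : σ * |t| ≤ |w| + |s| := by
      rw [← abs_of_pos hσ, ← abs_mul]
      have : σ * t = w - ρ * s := by rw [hw]; ring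
      rw [this]
      refine (abs_sub _ _).trans ?_
      rw [abs_mul]
      have := mul_le_mul_of_nonneg_right hρ1 (abs_nonneg s)
      linarith
    have hs0 := abs_nonneg s
    have hw0 := abs_nonneg w
    have ht0 := abs_nonneg t
    have hq0 : 0 ≤ q y := apply_nonneg p _
    have e4 : 8 * ε * B * |t| ≤ |w| + |s| := (mul_le_mul_of_nonneg_right hεB ht0).trans ht
    have e5 : 8 * ε * B * |s| ≤ |s| := by
      have := mul_le_mul_of_nonneg_right (hεB.trans hσ1) hs0
      linarith
    have e6 : ε * p x ≤ ε * q y + ε * |s| * B + ε * |t| * B := by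
      have := mul_le_mul_of_nonneg_left hpx hε
      linarith
    constructor <;> nlinarith
  rw [← lintegral_indicator_one hmeas, lintegral_decomp hb' (measurable_one.indicator hmeas)]
  have hm1 : Measurable fun y => ∫⁻ t, S.indicator (1 : E → ℝ≥0∞) (pr b' y + t • b')
      ∂(gaussianReal 0 1) :=
    Measurable.lintegral_prod_right' (f := fun z : E × ℝ =>
      S.indicator (1 : E → ℝ≥0∞) (pr b' z.1 + z.2 • b'))
      ((measurable_one.indicator hmeas).comp (by fun_prop))
  rw [lintegral_decomp ha hm1]
  have key : ∀ (y : E) (s : ℝ), ∫⁻ t, S.indicator (1 : E → ℝ≥0∞) (pr b' (pr a y + s • a) + t • b')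
      ∂(gaussianReal 0 1) ≤ (Set.Icc (-(4 * ε * q y)) (-(4 * ε * q y) + 2 * (4 * ε * q y))).indicator
        (fun _ => ENNReal.ofReal (4 * ε * q y / σ)) s := by
    intro y s
    set l := 4 * ε * q y with hl
    by_cases hs : s ∈ Set.Icc (-l) (-l + 2 * l)
    · rw [Set.indicator_of_mem hs]
      refine le_trans ?_ (gaussianReal_Icc_le ((-l - ρ * s) / σ) (l / σ))
      rw [← lintegral_indicator_one measurableSet_Icc]
      apply lintegral_mono
      intro t
      simp only
      by_cases ht : pr b' (pr a y + s • a) + t • b' ∈ S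
      · have h2 := abs_le.1 (hcore y s t ht).2
        rw [Set.indicator_of_mem ht, Set.indicator_of_mem]
        · simp
        · constructor
          · rw [div_le_iff₀ hσ]; linarith [h2.1]
          · have : (-l - ρ * s) / σ + 2 * (l / σ) = (l - ρ * s) / σ := by field_simp; ring
            rw [this, le_div_iff₀ hσ]; linarith [h2.2]
      · rw [Set.indicator_of_notMem ht]; exact zero_le
    · rw [Set.indicator_of_notMem hs]
      have : ∀ t : ℝ, S.indicator (1 : E → ℝ≥0∞) (pr b' (pr a y + s • a) + t • b') = 0 := by
        intro t
        rw [Set.indicator_of_notMem]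
        intro ht
        have h1 := abs_le.1 (hcore y s t ht).1
        exact hs ⟨h1.1, by linarith [h1.2]⟩
      simp only [this, lintegral_zero, le_refl]
  calc _ ≤ ∫⁻ y, ∫⁻ s, (Set.Icc (-(4 * ε * q y)) (-(4 * ε * q y) + 2 * (4 * ε * q y))).indicator
        (fun _ => ENNReal.ofReal (4 * ε * q y / σ)) s ∂(gaussianReal 0 1) ∂(stdGaussian E) :=
        lintegral_mono fun y => lintegral_mono fun s => key y s
    _ ≤ ∫⁻ y, ENNReal.ofReal (16 * ε ^ 2 / σ) * ENNReal.ofReal (q y ^ 2) ∂(stdGaussian E) := by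
        apply lintegral_mono
        intro y
        simp only
        have hq0 : 0 ≤ q y := apply_nonneg p _
        rw [lintegral_indicator measurableSet_Icc, setLIntegral_const]
        refine (mul_le_mul_right (gaussianReal_Icc_le _ _) _).trans ?_
        rw [← ENNReal.ofReal_mul (by positivity), ← ENNReal.ofReal_mul (by positivity)]
        apply ENNReal.ofReal_le_ofReal
        apply le_of_eq
        ring
    _ ≤ ENNReal.ofReal (16 * ε ^ 2 / σ) * ENNReal.ofReal (B ^ 2) := by
        rw [lintegral_const_mul _ (by simp only [hq]; fun_prop)]
        gcongr
        refine le_trans ?_ ((lintegral_seminorm_pr_le p hp hb').trans hp2)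
        have hcomp : Continuous (p.comp (pr b' : E →ₗ[ℝ] E)) := by
          change Continuous fun x => p (pr b' x)
          fun_prop
        exact lintegral_seminorm_pr_le (p.comp (pr b' : E →ₗ[ℝ] E)) hcomp ha
    _ = _ := by
        rw [← ENNReal.ofReal_mul (by positivity)]
        congr 1; ring

end Gaussian

/-! ### Part C: dyadic upper bound of line integrals -/

/-- half-open unit square -/
def Dsq : Set (ℝ × ℝ) := Set.Ico 0 1 ×ˢ Set.Ico 0 1

/-- dyadic cell -/
def Qc (k : ℕ) (i : ℕ × ℕ) : Set (ℝ × ℝ) :=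
  Set.Ico ((i.1 : ℝ) / 2 ^ k) (((i.1 : ℝ) + 1) / 2 ^ k) ×ˢ
    Set.Ico ((i.2 : ℝ) / 2 ^ k) (((i.2 : ℝ) + 1) / 2 ^ k)

def Ix (k : ℕ) : Finset (ℕ × ℕ) := Finset.range (2 ^ k) ×ˢ Finset.range (2 ^ k)

def idx (k : ℕ) (x : ℝ × ℝ) : ℕ × ℕ := (⌊2 ^ k * x.1⌋₊, ⌊2 ^ k * x.2⌋₊)

def epsk (k : ℕ) : ℝ := (1 / 2) ^ k

lemma epsk_pos (k : ℕ) : 0 < epsk k := by unfold epsk; positivity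

lemma epsk_eq (k : ℕ) : epsk k = 1 / 2 ^ k := by unfold epsk; rw [one_div_pow]

lemma epsk_tendsto : Tendsto epsk atTop (nhds 0) := by
  unfold epsk
  exact tendsto_pow_atTop_nhds_zero_of_lt_one (by norm_num) (by norm_num)

def Hc (h : ℝ × ℝ → ℝ≥0∞) (k : ℕ) (i : ℕ × ℕ) : ℝ≥0∞ := ⨅ x ∈ Qc k i, h x

lemma ico_floor {k m : ℕ} {t : ℝ} (ht : t ∈ Set.Ico ((m : ℝ) / 2 ^ k) (((m : ℝ) + 1) / 2 ^ k)) :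
    ⌊2 ^ k * t⌋₊ = m := by
  have h2 : (0 : ℝ) < 2 ^ k := by positivity
  have h1 := (div_le_iff₀ h2).1 ht.1
  have h3 := (lt_div_iff₀ h2).1 ht.2
  have : (0:ℝ) ≤ 2 ^ k * t := by
    have : (0:ℝ) ≤ m := Nat.cast_nonneg m
    linarith
  rw [Nat.floor_eq_iff this]
  constructor <;> linarith

lemma floor_ico (k : ℕ) {t : ℝ} (ht : 0 ≤ t) :
    t ∈ Set.Ico ((⌊2 ^ k * t⌋₊ : ℝ) / 2 ^ k) (((⌊2 ^ k * t⌋₊ : ℝ) + 1) / 2 ^ k) := by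
  have h2 : (0 : ℝ) < 2 ^ k := by positivity
  have h3 : (0:ℝ) ≤ 2 ^ k * t := by positivity
  constructor
  · rw [div_le_iff₀ h2]; have := Nat.floor_le h3; linarith
  · rw [lt_div_iff₀ h2]; have := Nat.lt_floor_add_one (2 ^ k * t); linarith

lemma floor_lt_pow (k : ℕ) {t : ℝ} (ht : t ∈ Set.Ico (0:ℝ) 1) : ⌊2 ^ k * t⌋₊ < 2 ^ k := by
  have h2 : (0 : ℝ) < 2 ^ k := by positivity
  have h3 : (0:ℝ) ≤ 2 ^ k * t := mul_nonneg h2.le ht.1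
  rw [Nat.floor_lt h3]
  push_cast
  nlinarith [ht.2]

lemma idx_of_mem {k : ℕ} {i : ℕ × ℕ} {x : ℝ × ℝ} (hx : x ∈ Qc k i) : idx k x = i := by
  obtain ⟨h1, h2⟩ := hx
  exact Prod.ext (ico_floor h1) (ico_floor h2)

lemma mem_Qc_idx (k : ℕ) {x : ℝ × ℝ} (hx : x ∈ Dsq) : x ∈ Qc k (idx k x) :=
  ⟨floor_ico k hx.1.1, floor_ico k hx.2.1⟩

lemma idx_mem (k : ℕ) {x : ℝ × ℝ} (hx : x ∈ Dsq) : idx k x ∈ Ix k := by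
  simp only [Ix, Finset.mem_product, Finset.mem_range]
  exact ⟨floor_lt_pow k hx.1, floor_lt_pow k hx.2⟩

lemma Qc_subset_Dsq {k : ℕ} {i : ℕ × ℕ} (hi : i ∈ Ix k) : Qc k i ⊆ Dsq := by
  simp only [Ix, Finset.mem_product, Finset.mem_range] at hi
  have h2 : (0 : ℝ) < 2 ^ k := by positivity
  have key : ∀ m : ℕ, m < 2 ^ k →
      Set.Ico ((m : ℝ) / 2 ^ k) (((m : ℝ) + 1) / 2 ^ k) ⊆ Set.Ico (0:ℝ) 1 := by
    intro m hm
    apply Set.Ico_subset_Ico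
    · positivity
    · rw [div_le_one h2]; exact_mod_cast hm
  exact Set.prod_mono (key _ hi.1) (key _ hi.2)

lemma idx_nested {k j : ℕ} (hkj : k ≤ j) (x : ℝ × ℝ) :
    idx k x = ((idx j x).1 / 2 ^ (j - k), (idx j x).2 / 2 ^ (j - k)) := by
  have key : ∀ t : ℝ, ⌊2 ^ k * t⌋₊ = ⌊2 ^ j * t⌋₊ / 2 ^ (j - k) := by
    intro t
    have h := Nat.floor_div_natCast (2 ^ j * t : ℝ) (2 ^ (j - k))
    rw [← h]
    congr 1
    push_cast
    rw [eq_div_iff (by positivity), mul_right_comm, ← pow_add]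
    congr 2
    omega
  exact Prod.ext (key _) (key _)

lemma Qc_nested {k j : ℕ} (hkj : k ≤ j) {i : ℕ × ℕ} {i' : ℕ × ℕ} {x : ℝ × ℝ}
    (hi' : i' ∈ Ix j) (hx : x ∈ Qc k i) (hx' : x ∈ Qc j i') : Qc j i' ⊆ Qc k i := by
  intro y hy
  have h1 := idx_nested hkj x
  have h2 := idx_nested hkj y
  rw [idx_of_mem hx'] at h1
  rw [idx_of_mem hy, ← h1, idx_of_mem hx] at h2
  rw [← h2]
  exact mem_Qc_idx k (Qc_subset_Dsq hi' hy)

lemma measurableSet_Qc (k : ℕ) (i : ℕ × ℕ) : MeasurableSet (Qc k i) :=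
  measurableSet_Ico.prod measurableSet_Ico

lemma measurableSet_Dsq : MeasurableSet Dsq := measurableSet_Ico.prod measurableSet_Ico

lemma Qc_dist {k : ℕ} {i : ℕ × ℕ} {x y : ℝ × ℝ} (hx : x ∈ Qc k i) (hy : y ∈ Qc k i) :
    dist x y ≤ epsk k := by
  obtain ⟨⟨h1, h2⟩, h3, h4⟩ := hx
  obtain ⟨⟨g1, g2⟩, g3, g4⟩ := hy
  rw [add_div, ← epsk_eq] at h2 h4 g2 g4
  rw [Prod.dist_eq, Real.dist_eq, Real.dist_eq, max_le_iff, abs_le, abs_le]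
  refine ⟨⟨?_, ?_⟩, ?_, ?_⟩ <;> linarith

lemma Qc_ediam (k : ℕ) (i : ℕ × ℕ) : Metric.ediam (Qc k i) ≤ ENNReal.ofReal (epsk k) := by
  apply Metric.ediam_le
  intro x hx y hy
  rw [edist_dist]
  exact ENNReal.ofReal_le_ofReal (Qc_dist hx hy)

lemma volume_Qc (k : ℕ) (i : ℕ × ℕ) : volume (Qc k i) = ENNReal.ofReal (epsk k ^ 2) := by
  unfold Qc
  rw [Measure.volume_eq_prod, Measure.prod_prod, Real.volume_Ico, Real.volume_Ico,
    ← ENNReal.ofReal_mul (by rw [← sub_div]; ring_nf; positivity), epsk_eq]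
  congr 1
  ring

lemma Dsq_eq_biUnion (k : ℕ) : Dsq = ⋃ i ∈ Ix k, Qc k i := by
  ext x
  simp only [Set.mem_iUnion]
  exact ⟨fun h => ⟨_, idx_mem k h, mem_Qc_idx k h⟩, fun ⟨i, hi, hx⟩ => Qc_subset_Dsq hi hx⟩

lemma Qc_disjoint {k : ℕ} {i j : ℕ × ℕ} (h : i ≠ j) : Disjoint (Qc k i) (Qc k j) := by
  rw [Set.disjoint_left]
  intro x hx hy
  exact h ((idx_of_mem hx).symm.trans (idx_of_mem hy))

/-- sum of infima is below the integral -/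
lemma sum_Hc_le (h : ℝ × ℝ → ℝ≥0∞) (k : ℕ) :
    ∑ i ∈ Ix k, Hc h k i * ENNReal.ofReal (epsk k ^ 2) ≤ ∫⁻ x in Dsq, h x := by
  rw [Dsq_eq_biUnion k, lintegral_biUnion_finset (fun i _ j _ hij => Qc_disjoint hij)
    (fun i _ => measurableSet_Qc k i)]
  apply Finset.sum_le_sum
  intro i _
  rw [← volume_Qc k i, ← setLIntegral_const]
  apply setLIntegral_mono' (measurableSet_Qc k i)
  intro x hx
  exact iInf₂_le x hx

lemma sum_liminf_le {ι : Type*} (s : Finset ι) (u : ι → ℕ → ℝ≥0∞) :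
    ∑ i ∈ s, liminf (u i) atTop ≤ liminf (fun j => ∑ i ∈ s, u i j) atTop := by
  let _ : MeasurableSpace s := ⊤
  have h := lintegral_liminf_le (u := atTop) (μ := (Measure.count : Measure s))
    (f := fun (j : ℕ) (i : s) => u i.1 j) (fun j => measurable_from_top)
  simp only [lintegral_count, tsum_fintype] at h
  rw [Finset.sum_coe_sort s (fun i => liminf (u i) atTop)] at h
  refine h.trans (le_of_eq ?_)
  congr 1
  ext j
  exact Finset.sum_coe_sort s (fun i => u i j)

open Classical in
lemma lineInt_le_liminf (h : ℝ × ℝ → ℝ≥0∞) (hh : LowerSemicontinuous h) {Z : Set (ℝ × ℝ)}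
    (hZ : MeasurableSet Z) :
    ∫⁻ x in Z ∩ Dsq, h x ∂(μH[1] : Measure (ℝ × ℝ)) ≤
      liminf (fun k => ∑ i ∈ Ix k, Hc h k i * ENNReal.ofReal (epsk k) *
        (if (Z ∩ Qc k i).Nonempty then 1 else 0)) atTop := by
  set hk : ℕ → ℝ × ℝ → ℝ≥0∞ := fun k x => Hc h k (idx k x) with hk_def
  have meas_idx : ∀ k, Measurable (idx k) := by
    intro k
    unfold idx
    fun_prop
  have hkm : ∀ k, Measurable (hk k) := fun k => (measurable_of_countable (Hc h k)).comp (meas_idx k)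
  have hZD : MeasurableSet (Z ∩ Dsq) := hZ.inter measurableSet_Dsq
  -- monotone
  have hmono : ∀ x ∈ Dsq, ∀ k j, k ≤ j → hk k x ≤ hk j x := by
    intro x hx k j hkj
    apply le_iInf₂
    intro y hy
    exact iInf₂_le y (Qc_nested hkj (idx_mem j hx) (mem_Qc_idx k hx) (mem_Qc_idx j hx) hy)
  have hsup : ∀ x ∈ Dsq, h x ≤ ⨆ k, hk k x := by
    intro x hx
    apply le_of_forall_lt
    intro a ha
    obtain ⟨b, hab, hb⟩ := exists_between ha
    have := hh x b hb
    obtain ⟨δ, hδ, hball⟩ := Metric.eventually_nhds_iff.1 this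
    obtain ⟨k, hk'⟩ := (epsk_tendsto.eventually (gt_mem_nhds hδ)).exists
    refine lt_of_lt_of_le hab (le_trans ?_ (le_iSup _ k))
    apply le_iInf₂
    intro y hy
    exact (hball (lt_of_le_of_lt (Qc_dist hy (mem_Qc_idx k hx)) hk')).le
  calc ∫⁻ x in Z ∩ Dsq, h x ∂(μH[1] : Measure (ℝ × ℝ))
      ≤ ∫⁻ x in Z ∩ Dsq, ⨆ k, hk k x ∂(μH[1] : Measure (ℝ × ℝ)) :=
        setLIntegral_mono' hZD fun x hx => hsup x hx.2
    _ = ⨆ k, ∫⁻ x in Z ∩ Dsq, hk k x ∂(μH[1] : Measure (ℝ × ℝ)) := by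
        apply lintegral_iSup' (fun k => (hkm k).aemeasurable)
        filter_upwards [ae_restrict_mem hZD] with x hx k j hkj
        exact hmono x hx.2 k j hkj
    _ ≤ _ := by
        apply iSup_le
        intro k
        have hdec : Z ∩ Dsq = ⋃ i ∈ Ix k, Z ∩ Qc k i := by
          rw [Dsq_eq_biUnion k, Set.inter_iUnion₂]
        rw [hdec, lintegral_biUnion_finset
          (fun i _ j _ hij => (Qc_disjoint hij).mono Set.inter_subset_right Set.inter_subset_right)
          (fun i _ => hZ.inter (measurableSet_Qc k i))]
        have e1 : ∀ i ∈ Ix k, ∫⁻ x in Z ∩ Qc k i, hk k x ∂(μH[1] : Measure (ℝ × ℝ)) ≤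
            liminf (fun j => Hc h k i * ∑ i' ∈ Ix j, Metric.ediam (Z ∩ Qc k i ∩ Qc j i')) atTop := by
          intro i hi
          have : ∫⁻ x in Z ∩ Qc k i, hk k x ∂(μH[1] : Measure (ℝ × ℝ)) =
              ∫⁻ x in Z ∩ Qc k i, Hc h k i ∂(μH[1] : Measure (ℝ × ℝ)) := by
            apply setLIntegral_congr_fun (hZ.inter (measurableSet_Qc k i))
            intro x hx
            simp only [hk_def, idx_of_mem hx.2]
          rw [this, setLIntegral_const]
          have hm := Measure.hausdorffMeasure_le_liminf_sum (ι := fun j => ↥(Ix j)) 1 (Z ∩ Qc k i)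
            (l := atTop) (fun j => ENNReal.ofReal (epsk j))
            (by simpa using ENNReal.tendsto_ofReal epsk_tendsto)
            (fun j i' => Z ∩ Qc k i ∩ Qc j i'.1)
            (Eventually.of_forall fun j i' =>
              (Metric.ediam_mono Set.inter_subset_right).trans (Qc_ediam j i'.1))
            (Eventually.of_forall fun j x hx => by
              have hxD := Qc_subset_Dsq hi hx.2
              exact Set.mem_iUnion.2 ⟨⟨idx j x, idx_mem j hxD⟩, hx, mem_Qc_idx j hxD⟩)
          have := mul_le_mul_right hm (Hc h k i)
          refine this.trans ?_
          have h3 := ENNReal.le_liminf_mul (f := atTop) (u := fun _ : ℕ => Hc h k i)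
            (v := fun j => ∑ i' : ↥(Ix j), Metric.ediam (Z ∩ Qc k i ∩ Qc j i'.1) ^ (1:ℝ))
          rw [liminf_const] at h3
          refine h3.trans (le_of_eq ?_)
          congr 1
          ext j
          simp only [Pi.mul_apply, ENNReal.rpow_one]
          congr 1
          exact Finset.sum_coe_sort (Ix j) (fun i' => Metric.ediam (Z ∩ Qc k i ∩ Qc j i'))
        refine (Finset.sum_le_sum e1).trans ((sum_liminf_le _ _).trans ?_)
        refine liminf_le_liminf ?_
        filter_upwards [eventually_ge_atTop k] with j hj
        simp_rw [Finset.mul_sum]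
        rw [Finset.sum_comm]
        apply Finset.sum_le_sum
        intro i' hi'
        by_cases hne : (Z ∩ Qc j i').Nonempty
        · rw [if_pos hne, mul_one]
          obtain ⟨x, hxZ, hx⟩ := hne
          have hxD := Qc_subset_Dsq hi' hx
          rw [Finset.sum_eq_single (idx k x)]
          · gcongr
            · apply le_iInf₂
              intro y hy
              exact iInf₂_le y (Qc_nested hj hi' (mem_Qc_idx k hxD) hx hy)
            · exact (Metric.ediam_mono Set.inter_subset_right).trans (Qc_ediam j i')
          · intro i _ hne
            have : Z ∩ Qc k i ∩ Qc j i' = ∅ := by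
              rw [Set.eq_empty_iff_forall_notMem]
              rintro y ⟨⟨_, hy⟩, hy'⟩
              exact hne (idx_of_mem (Qc_nested hj hi' hy hy' hx)).symm
            rw [this]; simp
          · intro hn
            exact absurd (idx_mem k hxD) hn
        · rw [if_neg hne, mul_zero]
          apply le_of_eq
          apply Finset.sum_eq_zero
          intro i _
          have : Z ∩ Qc k i ∩ Qc j i' = ∅ := by
            rw [Set.eq_empty_iff_forall_notMem]
            rintro y ⟨⟨hyZ, hy⟩, hy'⟩
            exact hne ⟨y, hyZ, hy'⟩
          rw [this]; simp

/-! ### Part D1: pair probabilities and lattice sums -/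

lemma sum_inv_sqrt (J : ℕ) : ∑ a ∈ Finset.range J, 1 / √((a : ℝ) + 1) ≤ 2 * √(J : ℝ) := by
  induction J with
  | zero => simp
  | succ n ih =>
    rw [Finset.sum_range_succ]
    push_cast
    have h1 : 0 < √((n : ℝ) + 1) := Real.sqrt_pos.2 (by positivity)
    have h2 : √((n : ℝ) + 1) ^ 2 = n + 1 := Real.sq_sqrt (by positivity)
    have h3 : √(n : ℝ) ^ 2 = n := Real.sq_sqrt (by positivity)
    have h4 : 1 / √((n : ℝ) + 1) ≤ 2 * √((n : ℝ) + 1) - 2 * √(n : ℝ) := by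
      rw [div_le_iff₀ h1]
      nlinarith [sq_nonneg (√((n : ℝ) + 1) - √(n : ℝ))]
    linarith

lemma sum_dist_le (F : ℕ → ℝ) (hF : ∀ a, 0 ≤ F a) (N i J : ℕ) :
    ∑ j ∈ Finset.range N, (if Nat.dist i j ≤ J then F (Nat.dist i j) else 0) ≤
      2 * ∑ a ∈ Finset.range (J + 1), F a := by
  rw [← Finset.sum_filter, ← Finset.sum_filter_add_sum_filter_not _ (fun j => j ≤ i), two_mul]
  apply add_le_add
  · rw [← Finset.sum_image (f := F) (g := fun j => Nat.dist i j)]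
    · apply Finset.sum_le_sum_of_subset_of_nonneg
      · intro a ha
        simp only [Finset.mem_image, Finset.mem_filter, Finset.mem_range] at ha ⊢
        obtain ⟨j, ⟨⟨_, h⟩, _⟩, rfl⟩ := ha
        omega
      · intro a _ _; exact hF a
    · intro x hx y hy hxy
      simp only [Finset.coe_filter, Set.mem_ofPred_eq, Nat.dist] at hx hy hxy
      omega
  · rw [← Finset.sum_image (f := F) (g := fun j => Nat.dist i j)]
    · apply Finset.sum_le_sum_of_subset_of_nonneg
      · intro a ha
        simp only [Finset.mem_image, Finset.mem_filter, Finset.mem_range] at ha ⊢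
        obtain ⟨j, ⟨⟨_, h⟩, _⟩, rfl⟩ := ha
        omega
      · intro a _ _; exact hF a
    · intro x hx y hy hxy
      simp only [Finset.coe_filter, Set.mem_ofPred_eq, Nat.dist] at hx hy hxy
      omega

/-- sup distance of lattice points -/
def rd (i j : ℕ × ℕ) : ℕ := max (Nat.dist i.1 j.1) (Nat.dist i.2 j.2)

lemma lattice_sum (N J : ℕ) (i : ℕ × ℕ) :
    ∑ j ∈ Finset.range N ×ˢ Finset.range N,
      (if rd i j ≤ J then 1 / ((rd i j : ℝ) + 1) else 0) ≤ 16 * ((J : ℝ) + 1) := by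
  set G : ℕ → ℕ → ℝ := fun i j =>
    if Nat.dist i j ≤ J then 1 / √((Nat.dist i j : ℝ) + 1) else 0 with hG
  have hGn : ∀ i j, 0 ≤ G i j := by
    intro i j; simp only [hG]; split_ifs <;> positivity
  have h1 : ∀ i : ℕ, ∑ j ∈ Finset.range N, G i j ≤ 4 * √((J : ℝ) + 1) := by
    intro i
    have := sum_dist_le (fun a => 1 / √((a : ℝ) + 1)) (fun a => by positivity) N i J
    have h2 := sum_inv_sqrt (J + 1)
    push_cast at h2
    simp only [hG]
    linarith
  calc _ ≤ ∑ j ∈ Finset.range N ×ˢ Finset.range N, G i.1 j.1 * G i.2 j.2 := by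
        apply Finset.sum_le_sum
        intro j _
        by_cases h : rd i j ≤ J
        · have ha : Nat.dist i.1 j.1 ≤ rd i j := le_max_left _ _
          have hb : Nat.dist i.2 j.2 ≤ rd i j := le_max_right _ _
          simp only [hG]
          rw [if_pos h, if_pos (ha.trans h), if_pos (hb.trans h), div_mul_div_comm, one_mul,
            ← Real.sqrt_mul (by positivity)]
          have ha' : (Nat.dist i.1 j.1 : ℝ) ≤ rd i j := by exact_mod_cast ha
          have hb' : (Nat.dist i.2 j.2 : ℝ) ≤ rd i j := by exact_mod_cast hb
          apply one_div_le_one_div_of_le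
          · apply Real.sqrt_pos.2; positivity
          · rw [Real.sqrt_le_left (by positivity), sq]
            gcongr
        · rw [if_neg h]; exact mul_nonneg (hGn _ _) (hGn _ _)
    _ = (∑ j ∈ Finset.range N, G i.1 j) * ∑ j ∈ Finset.range N, G i.2 j := by
        rw [Finset.sum_mul_sum, Finset.sum_product]
    _ ≤ (4 * √((J : ℝ) + 1)) * (4 * √((J : ℝ) + 1)) := by
        apply mul_le_mul (h1 _) (h1 _) (Finset.sum_nonneg fun j _ => hGn _ _) (by positivity)
    _ = 16 * ((J : ℝ) + 1) := by
        have := Real.mul_self_sqrt (show 0 ≤ (J : ℝ) + 1 by positivity)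
        linear_combination 16 * this

section pair

set_option linter.unusedSectionVars false

variable {E : Type*} [NormedAddCommGroup E] [InnerProductSpace ℝ E] [FiniteDimensional ℝ E]
  [MeasurableSpace E] [BorelSpace E]

lemma lintegral_inner_sq (d : E) :
    ∫⁻ x, ENNReal.ofReal (⟪d, x⟫ ^ 2) ∂(stdGaussian E) = ENNReal.ofReal (‖d‖ ^ 2) := by
  have hm : MemLp (fun x : E => ⟪d, x⟫) 2 (stdGaussian E) :=
    IsGaussian.memLp_dual (stdGaussian E) (innerSL ℝ d) 2 (by norm_num)
  rw [← ofReal_integral_eq_lintegral_ofReal hm.integrable_sq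
    (Eventually.of_forall fun x => sq_nonneg _)]
  congr 1
  have h := variance_dual_stdGaussian (innerSL ℝ d)
  rw [variance_of_integral_eq_zero (innerSL ℝ d).continuous.aemeasurable
    (integral_strongDual_stdGaussian _)] at h
  simpa using h

lemma lintegral_norm_sq :
    ∫⁻ x, ENNReal.ofReal (‖x‖ ^ 2) ∂(stdGaussian E) = ENNReal.ofReal (Module.finrank ℝ E) := by
  set b := stdOrthonormalBasis ℝ E
  have : ∀ x : E, ENNReal.ofReal (‖x‖ ^ 2) = ∑ i, ENNReal.ofReal (⟪b i, x⟫ ^ 2) := by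
    intro x
    rw [← ENNReal.ofReal_sum_of_nonneg (fun i _ => sq_nonneg _), ← b.sum_sq_norm_inner_right x]
    simp
  simp_rw [this]
  rw [lintegral_finsetSum _ (fun i _ => by fun_prop)]
  simp_rw [lintegral_inner_sq]
  simp

/-- seminorm controlling the increments over a cell -/
def pS (d d' : E) (η : ℝ≥0) : Seminorm ℝ E :=
  (normSeminorm ℝ ℝ).comp (innerSL ℝ d).toLinearMap +
    (normSeminorm ℝ ℝ).comp (innerSL ℝ d').toLinearMap + η • normSeminorm ℝ E

lemma pS_apply (d d' : E) (η : ℝ≥0) (x : E) :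
    pS d d' η x = |⟪d, x⟫| + |⟪d', x⟫| + η * ‖x‖ := by
  simp [pS, NNReal.smul_def]

lemma pS_continuous (d d' : E) (η : ℝ≥0) : Continuous (pS d d' η) := by
  have : ⇑(pS d d' η) = fun x : E => |⟪d, x⟫| + |⟪d', x⟫| + η * ‖x‖ := by
    ext x; exact pS_apply _ _ _ _
  rw [this]; fun_prop

/-- hitting event of a cell -/
def Aev (ε : ℝ) (a d d' : E) (η : ℝ≥0) : Set E := {x | |⟪a, x⟫| ≤ ε * pS d d' η x}

lemma measurableSet_Aev (ε : ℝ) (a d d' : E) (η : ℝ≥0) : MeasurableSet (Aev ε a d d' η) := by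
  have := pS_continuous d d' η
  exact (isClosed_le (by fun_prop) (by fun_prop)).measurableSet

lemma pS_bounds {Λ : ℝ} (hΛ : 0 < Λ) {d1 d2 d3 d4 : E} {η : ℝ≥0}
    (h1 : ‖d1‖ ≤ 2 * Λ) (h2 : ‖d2‖ ≤ 2 * Λ) (h3 : ‖d3‖ ≤ 2 * Λ) (h4 : ‖d4‖ ≤ 2 * Λ)
    (hη : (η : ℝ) * (Module.finrank ℝ E + 1) ≤ Λ) :
    (∀ v, (pS d1 d2 η + pS d3 d4 η) v ≤ (10 * Λ) * ‖v‖) ∧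
    ∫⁻ x, ENNReal.ofReal ((pS d1 d2 η + pS d3 d4 η) x ^ 2) ∂(stdGaussian E) ≤
      ENNReal.ofReal ((10 * Λ) ^ 2) := by
  have hη0 : (0:ℝ) ≤ η := η.2
  have hm0 : (0:ℝ) ≤ Module.finrank ℝ E := Nat.cast_nonneg _
  have hηΛ : (η : ℝ) ≤ Λ := by nlinarith
  have hη2 : (η : ℝ) ^ 2 * Module.finrank ℝ E ≤ Λ ^ 2 := by
    nlinarith [mul_nonneg hη0 hm0]
  constructor
  · intro v
    rw [add_apply, pS_apply, pS_apply]
    have hh : ∀ d : E, ‖d‖ ≤ 2 * Λ → |⟪d, v⟫| ≤ 2 * Λ * ‖v‖ := fun d hd =>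
      (abs_real_inner_le_norm d v).trans (by gcongr)
    have e := mul_le_mul_of_nonneg_right hηΛ (norm_nonneg v)
    linarith [hh d1 h1, hh d2 h2, hh d3 h3, hh d4 h4]
  · have key : ∀ x : E, ENNReal.ofReal ((pS d1 d2 η + pS d3 d4 η) x ^ 2) ≤
        ENNReal.ofReal 5 * (ENNReal.ofReal (⟪d1, x⟫ ^ 2) + ENNReal.ofReal (⟪d2, x⟫ ^ 2) +
          ENNReal.ofReal (⟪d3, x⟫ ^ 2) + ENNReal.ofReal (⟪d4, x⟫ ^ 2) +
          ENNReal.ofReal (4 * η ^ 2) * ENNReal.ofReal (‖x‖ ^ 2)) := by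
      intro x
      rw [← ENNReal.ofReal_mul (by positivity), ← ENNReal.ofReal_add (by positivity) (by positivity),
        ← ENNReal.ofReal_add (by positivity) (by positivity),
        ← ENNReal.ofReal_add (by positivity) (by positivity),
        ← ENNReal.ofReal_add (by positivity) (by positivity), ← ENNReal.ofReal_mul (by norm_num)]
      apply ENNReal.ofReal_le_ofReal
      rw [add_apply, pS_apply, pS_apply, ← sq_abs ⟪d1, x⟫, ← sq_abs ⟪d2, x⟫,
        ← sq_abs ⟪d3, x⟫, ← sq_abs ⟪d4, x⟫]
      generalize |⟪d1, x⟫| = a1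
      generalize |⟪d2, x⟫| = a2
      generalize |⟪d3, x⟫| = a3
      generalize |⟪d4, x⟫| = a4
      generalize hz : (η : ℝ) * ‖x‖ = z
      have : 4 * (η : ℝ) ^ 2 * ‖x‖ ^ 2 = (2 * z) ^ 2 := by rw [← hz]; ring
      rw [this]
      nlinarith [sq_nonneg (a1 - a2), sq_nonneg (a1 - a3), sq_nonneg (a1 - a4),
        sq_nonneg (a1 - 2 * z), sq_nonneg (a2 - a3), sq_nonneg (a2 - a4), sq_nonneg (a2 - 2 * z),
        sq_nonneg (a3 - a4), sq_nonneg (a3 - 2 * z), sq_nonneg (a4 - 2 * z)]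
    refine (lintegral_mono key).trans ?_
    rw [lintegral_const_mul _ (by fun_prop), lintegral_add_left (by fun_prop),
      lintegral_add_left (by fun_prop), lintegral_add_left (by fun_prop),
      lintegral_add_left (by fun_prop), lintegral_const_mul _ (by fun_prop),
      lintegral_inner_sq, lintegral_inner_sq, lintegral_inner_sq, lintegral_inner_sq,
      lintegral_norm_sq]
    rw [← ENNReal.ofReal_mul (by positivity), ← ENNReal.ofReal_add (by positivity) (by positivity),
        ← ENNReal.ofReal_add (by positivity) (by positivity),
        ← ENNReal.ofReal_add (by positivity) (by positivity),
        ← ENNReal.ofReal_add (by positivity) (by positivity), ← ENNReal.ofReal_mul (by norm_num)]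
    apply ENNReal.ofReal_le_ofReal
    have hh : ∀ d : E, ‖d‖ ≤ 2 * Λ → ‖d‖ ^ 2 ≤ 4 * Λ ^ 2 := fun d hd => by
      nlinarith [norm_nonneg d]
    nlinarith [hh d1 h1, hh d2 h2, hh d3 h3, hh d4 h4]

/-- the pair constant -/
def C1 (s : ℝ) : ℝ := 20 * (1 + 80 / s) + 3200 / s

lemma pair_bound {Λ ε s : ℝ} (hΛ : 0 < Λ) (hε : 0 < ε) (hs : 0 < s) {a b d1 d2 d3 d4 : E} {η : ℝ≥0}
    (ha : ‖a‖ = 1) (hb : ‖b‖ = 1)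
    (h1 : ‖d1‖ ≤ 2 * Λ) (h2 : ‖d2‖ ≤ 2 * Λ) (h3 : ‖d3‖ ≤ 2 * Λ) (h4 : ‖d4‖ ≤ 2 * Λ)
    (hη : (η : ℝ) * (Module.finrank ℝ E + 1) ≤ Λ) (r J : ℕ)
    (hab : s ^ 2 * min 1 (Λ ^ 2 * (ε * r) ^ 2) ≤ 1 - ⟪a, b⟫ ^ 2)
    (hε1 : 80 * ε * Λ ≤ s) (hε2 : 20 * ε * Λ ≤ 1)
    (hJ : J = ⌊1 / (Λ * ε)⌋₊) :
    stdGaussian E (Aev ε a d1 d2 η ∩ Aev ε b d3 d4 η) ≤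
      ENNReal.ofReal (C1 s * (ε ^ 2 * Λ ^ 2 + ε * Λ * (if r ≤ J then 1 / ((r : ℝ) + 1) else 0))) := by
  obtain ⟨hB1, hB2⟩ := pS_bounds hΛ h1 h2 h3 h4 hη
  set p := pS d1 d2 η + pS d3 d4 η with hp
  have hpc : Continuous p := by
    have e : ⇑p = fun x : E => pS d1 d2 η x + pS d3 d4 η x := by ext x; simp [hp]
    have := pS_continuous d1 d2 η
    have := pS_continuous d3 d4 η
    rw [e]; fun_prop
  have hsub : Aev ε a d1 d2 η ∩ Aev ε b d3 d4 η ⊆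
      {x | |⟪a, x⟫| ≤ ε * p x ∧ |⟪b, x⟫| ≤ ε * p x} := by
    rintro x ⟨hx1, hx2⟩
    simp only [Aev, Set.mem_ofPred_eq] at hx1 hx2 ⊢
    have g1 := apply_nonneg (pS d1 d2 η) x
    have g2 := apply_nonneg (pS d3 d4 η) x
    rw [hp, add_apply]
    constructor <;> nlinarith
  have hΛε : 0 < Λ * ε := by positivity
  have hsinv : 0 < 1 / s := by positivity
  have hJiff : r ≤ J ↔ (r : ℝ) * (Λ * ε) ≤ 1 := by
    rw [hJ, Nat.le_floor_iff (by positivity), le_div_iff₀ hΛε]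
  by_cases hr : (r : ℝ) * s < 80
  · -- near
    have hrJ : r ≤ J := by
      rw [hJiff]
      have : (r : ℝ) * (80 * ε * Λ) ≤ r * s := by gcongr
      nlinarith
    have hone := one_point p hpc (B := 10 * Λ) (by positivity) hε.le hB1 hB2 ha (by linarith)
    refine (measure_mono (hsub.trans fun x hx => hx.1)).trans (hone.trans ?_)
    apply ENNReal.ofReal_le_ofReal
    rw [if_pos hrJ]
    have hr' : (r : ℝ) + 1 ≤ 1 + 80 / s := by
      have := (lt_div_iff₀ hs).2 hr
      linarith
    have : 1 ≤ (1 + 80 / s) * (1 / ((r : ℝ) + 1)) := by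
      rw [mul_one_div, le_div_iff₀ (by positivity)]; linarith
    unfold C1
    have q1 : 0 ≤ (20 * (1 + 80 / s) + 3200 / s) * (ε ^ 2 * Λ ^ 2) := by positivity
    have q2 : 0 ≤ 3200 / s * (ε * Λ * (1 / ((r : ℝ) + 1))) := by positivity
    nlinarith [mul_le_mul_of_nonneg_left this (show 0 ≤ 20 * (ε * Λ) by positivity)]
  · -- far
    push Not at hr
    have hr0 : 0 < (r : ℝ) := by
      rcases Nat.eq_zero_or_pos r with h | h
      · rw [h] at hr; norm_num at hr
      · exact_mod_cast h
    have hr1 : (1:ℝ) ≤ r := by exact_mod_cast Nat.one_le_iff_ne_zero.2 (by rintro rfl; simp at hr0)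
    set m := min 1 (Λ * (ε * r)) with hm
    have hm0 : 0 < m := lt_min one_pos (by positivity)
    have hm2 : m ^ 2 ≤ min 1 (Λ ^ 2 * (ε * r) ^ 2) := by
      apply le_min
      · exact pow_le_one₀ hm0.le (min_le_left _ _)
      · rw [← mul_pow]; exact pow_le_pow_left₀ hm0.le (min_le_right _ _) 2
    have hσ2 : (s * m) ^ 2 ≤ 1 - ⟪a, b⟫ ^ 2 := by
      rw [mul_pow]; exact (by gcongr : s ^ 2 * m ^ 2 ≤ s ^ 2 * _).trans hab
    have hσp : 0 < 1 - ⟪a, b⟫ ^ 2 := lt_of_lt_of_le (by positivity) hσ2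
    set σ := √(1 - ⟪a, b⟫ ^ 2) with hσ
    have hsm : s * m ≤ σ := Real.le_sqrt_of_sq_le hσ2
    have hle : 8 * ε * (10 * Λ) ≤ s * m := by
      rcases min_choice 1 (Λ * (ε * r)) with h | h
      · rw [hm, h]; linarith
      · rw [hm, h]
        have : ε * Λ * 80 ≤ ε * Λ * (r * s) := by gcongr
        linarith
    have htwo := two_point p hpc (B := 10 * Λ) (by positivity) hε.le hB1 hB2 ha hb
      (Real.sqrt_pos.2 hσp) (Real.sq_sqrt hσp.le) (hle.trans hsm)
    refine (measure_mono hsub).trans (htwo.trans ?_)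
    apply ENNReal.ofReal_le_ofReal
    have hsm0 : 0 < s * m := by positivity
    have e1 : 16 * ε ^ 2 * (10 * Λ) ^ 2 / √(1 - ⟪a, b⟫ ^ 2) ≤ 16 * ε ^ 2 * (10 * Λ) ^ 2 / (s * m) := by
      gcongr
    refine e1.trans ?_
    have e2 : ε ^ 2 * Λ ^ 2 / m ≤ ε ^ 2 * Λ ^ 2 + 2 * (ε * Λ * (if r ≤ J then 1 / ((r : ℝ) + 1) else 0)) := by
      rcases le_total 1 (Λ * (ε * r)) with h | h
      · rw [hm, min_eq_left h, div_one]
        have : (0:ℝ) ≤ if r ≤ J then 1 / ((r : ℝ) + 1) else 0 := by split_ifs <;> positivity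
        have := mul_nonneg (mul_nonneg hε.le hΛ.le) this
        linarith
      · have hrJ : r ≤ J := by rw [hJiff]; linarith
        rw [if_pos hrJ, hm, min_eq_right h]
        have : ε ^ 2 * Λ ^ 2 / (Λ * (ε * r)) = ε * Λ * (1 / r) := by
          field_simp
        rw [this]
        have h5 : 1 / (r : ℝ) ≤ 2 * (1 / ((r : ℝ) + 1)) := by
          rw [mul_one_div, div_le_div_iff₀ hr0 (by positivity)]; linarith
        have := mul_le_mul_of_nonneg_left h5 (mul_nonneg hε.le hΛ.le)
        have : 0 ≤ ε ^ 2 * Λ ^ 2 := by positivity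
        linarith
    have e3 : 16 * ε ^ 2 * (10 * Λ) ^ 2 / (s * m) = 1600 / s * (ε ^ 2 * Λ ^ 2 / m) := by
      field_simp; norm_num
    rw [e3]
    have e4 := mul_le_mul_of_nonneg_left e2 (show 0 ≤ 1600 / s by positivity)
    unfold C1
    have : (0:ℝ) ≤ if r ≤ J then 1 / ((r : ℝ) + 1) else 0 := by split_ifs <;> positivity
    have q1 : 0 ≤ (20 * (1 + 80 / s)) * (ε ^ 2 * Λ ^ 2 + ε * Λ * (if r ≤ J then 1 / ((r : ℝ) + 1) else 0)) := by
      positivity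
    have q2 : 0 ≤ 1600 / s * (ε ^ 2 * Λ ^ 2) := by positivity
    have e5 : (3200 / s : ℝ) = 2 * (1600 / s) := by ring
    rw [e5]
    linarith

end pair

/-! ### Part D2: the flat second moment bound -/

/-- closed unit square -/
def Ksq : Set (ℝ × ℝ) := Set.Icc 0 1 ×ˢ Set.Icc 0 1

lemma Dsq_subset_Ksq : Dsq ⊆ Ksq := Set.prod_mono Set.Ico_subset_Icc_self Set.Ico_subset_Icc_self

lemma isCompact_Ksq : IsCompact Ksq := isCompact_Icc.prod isCompact_Icc

lemma convex_Ksq : Convex ℝ Ksq := (convex_Icc _ _).prod (convex_Icc _ _)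

/-- corner of cell -/
def uc (k : ℕ) (i : ℕ × ℕ) : ℝ × ℝ := (i.1 * epsk k, i.2 * epsk k)

lemma uc_mem (k : ℕ) (i : ℕ × ℕ) : uc k i ∈ Qc k i := by
  have := epsk_pos k
  constructor <;> simp only [uc, Set.mem_Ico, add_div, ← epsk_eq] <;>
    rw [← mul_one_div, ← epsk_eq] <;> constructor <;> linarith

lemma natdist_cast (a b : ℕ) : (Nat.dist a b : ℝ) = |(a : ℝ) - b| := by
  rcases le_total a b with h | h
  · rw [Nat.dist_eq_sub_of_le h, Nat.cast_sub h, abs_of_nonpos]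
    · ring
    · have : (a:ℝ) ≤ b := by exact_mod_cast h
      linarith
  · rw [Nat.dist_eq_sub_of_le_right h, Nat.cast_sub h, abs_of_nonneg]
    have : (b:ℝ) ≤ a := by exact_mod_cast h
    linarith

lemma dist_uc (k : ℕ) (i j : ℕ × ℕ) : dist (uc k i) (uc k j) = epsk k * rd i j := by
  have := epsk_pos k
  rw [Prod.dist_eq, Real.dist_eq, Real.dist_eq, uc, uc, rd, Nat.cast_max, natdist_cast,
    natdist_cast]
  simp only
  rw [← sub_mul, ← sub_mul, abs_mul, abs_mul, abs_of_pos this, mul_max_of_nonneg _ _ this.le,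
    mul_comm, mul_comm (epsk k)]
  congr 1
  ring

lemma pair_sum_bound {ι : Type*} (I : Finset ι) (H : ι → ℝ≥0∞) (P : ι → ι → ℝ≥0∞) (w : ι → ι → ℝ)
    {M A : ℝ≥0∞} {Λ ε C : ℝ} (hΛ : 0 < Λ) (hε : 0 < ε) (hC : 0 ≤ C)
    (hM : ∀ i, H i ≤ M) (hw : ∀ i j, 0 ≤ w i j)
    (hP : ∀ i ∈ I, ∀ j ∈ I, P i j ≤ ENNReal.ofReal (C * (ε ^ 2 * Λ ^ 2 + ε * Λ * w i j)))
    (hws : ∀ i ∈ I, ε * Λ * ∑ j ∈ I, w i j ≤ 32)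
    (hA : ∑ i ∈ I, H i * ENNReal.ofReal (ε ^ 2) ≤ A) :
    ∑ i ∈ I, ∑ j ∈ I, (H i * ENNReal.ofReal ε) * (H j * ENNReal.ofReal ε) * P i j ≤
      ENNReal.ofReal (32 * C) * (ENNReal.ofReal (Λ ^ 2) * A ^ 2 + M * A) := by
  set e := ENNReal.ofReal (ε ^ 2) with he
  have hee : ENNReal.ofReal ε * ENNReal.ofReal ε = e := by
    rw [he, ← ENNReal.ofReal_mul hε.le, sq]
  have step : ∀ i ∈ I, ∑ j ∈ I, (H i * ENNReal.ofReal ε) * (H j * ENNReal.ofReal ε) * P i j ≤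
      ENNReal.ofReal C * (ENNReal.ofReal (Λ ^ 2) * ((H i * e) * A) +
        (H i * e) * (M * ENNReal.ofReal 32)) := by
    intro i hi
    have t : ∀ j ∈ I, (H i * ENNReal.ofReal ε) * (H j * ENNReal.ofReal ε) * P i j ≤
      ENNReal.ofReal C * (ENNReal.ofReal (Λ ^ 2) * ((H i * e) * (H j * e)) +
        (H i * e) * (M * ENNReal.ofReal (ε * Λ * w i j))) := by
      intro j hj
      have w0 := hw i j
      calc (H i * ENNReal.ofReal ε) * (H j * ENNReal.ofReal ε) * P i j
          = (H i * e) * H j * P i j := by rw [← hee]; ring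
        _ ≤ (H i * e) * H j * (ENNReal.ofReal C * (e * ENNReal.ofReal (Λ ^ 2) +
              ENNReal.ofReal (ε * Λ * w i j))) := by
            gcongr
            refine (hP i hi j hj).trans (le_of_eq ?_)
            rw [ENNReal.ofReal_mul hC, ENNReal.ofReal_add (by positivity) (by positivity),
              ENNReal.ofReal_mul (by positivity)]
        _ = ENNReal.ofReal C * (ENNReal.ofReal (Λ ^ 2) * ((H i * e) * (H j * e)) +
        (H i * e) * (H j * ENNReal.ofReal (ε * Λ * w i j))) := by ring
        _ ≤ _ := by gcongr; exact hM j
    refine (Finset.sum_le_sum t).trans ?_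
    rw [← Finset.mul_sum, Finset.sum_add_distrib, ← Finset.mul_sum, ← Finset.mul_sum,
      ← Finset.mul_sum, ← Finset.mul_sum, ← ENNReal.ofReal_sum_of_nonneg
        (fun j _ => by have := hw i j; positivity), ← Finset.mul_sum]
    gcongr
    exact hws i hi
  refine (Finset.sum_le_sum step).trans ?_
  rw [← Finset.mul_sum, Finset.sum_add_distrib, ← Finset.mul_sum,
    ← Finset.sum_mul I (fun i => H i * e) A, ← Finset.sum_mul I (fun i => H i * e)]
  calc _ ≤ ENNReal.ofReal C * (ENNReal.ofReal (Λ ^ 2) * (A * A) + A * (M * ENNReal.ofReal 32)) := by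
        gcongr
    _ ≤ ENNReal.ofReal C * (ENNReal.ofReal 32 * (ENNReal.ofReal (Λ ^ 2) * (A * A)) +
          A * (M * ENNReal.ofReal 32)) := by
        have h32 : (1 : ℝ≥0∞) ≤ ENNReal.ofReal 32 := ENNReal.one_le_ofReal.2 (by norm_num)
        exact mul_le_mul' le_rfl (add_le_add (le_mul_of_one_le_left zero_le h32) le_rfl)
    _ = _ := by
        rw [ENNReal.ofReal_mul (by norm_num)]; ring

section core

set_option linter.unusedSectionVars false

variable {E : Type*} [NormedAddCommGroup E] [InnerProductSpace ℝ E] [FiniteDimensional ℝ E]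
  [MeasurableSpace E] [BorelSpace E]

lemma taylor_sq {g : ℝ × ℝ → E} (hg : ContDiff ℝ 2 g) :
    ∃ T : ℝ≥0, ∀ u ∈ Ksq, ∀ v ∈ Ksq, ‖g v - g u - fderiv ℝ g u (v - u)‖ ≤ T * ‖v - u‖ ^ 2 := by
  have h1 : ContDiff ℝ 1 (fderiv ℝ g) := hg.fderiv_right (by norm_num)
  have h2 : Continuous (fderiv ℝ (fderiv ℝ g)) := h1.continuous_fderiv (by norm_num)
  obtain ⟨T, hT⟩ := isCompact_Ksq.exists_bound_of_continuousOn (E := ℝ × ℝ →L[ℝ] ℝ × ℝ →L[ℝ] E)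
    (f := fderiv ℝ (fderiv ℝ g)) h2.continuousOn
  have hT0 : 0 ≤ max T 0 := le_max_right _ _
  have hlip : ∀ u ∈ Ksq, ∀ v ∈ Ksq, ‖fderiv ℝ g v - fderiv ℝ g u‖ ≤ max T 0 * ‖v - u‖ := by
    intro u hu v hv
    exact convex_Ksq.norm_image_sub_le_of_norm_fderiv_le (𝕜 := ℝ)
      (fun x _ => (h1.differentiable (by norm_num)) x)
      (fun x hx => (hT x hx).trans (le_max_left _ _)) hu hv
  refine ⟨(max T 0).toNNReal, fun u hu v hv => ?_⟩
  have hseg : segment ℝ u v ⊆ Ksq := convex_Ksq.segment_subset hu hv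
  have := (convex_segment u v).norm_image_sub_le_of_norm_fderiv_le' (𝕜 := ℝ) (f := g)
    (φ := fderiv ℝ g u) (C := max T 0 * ‖v - u‖)
    (fun x _ => (hg.differentiable (by norm_num)) x)
    (fun x hx => by
      refine (hlip u hu x (hseg hx)).trans ?_
      gcongr
      rw [← dist_eq_norm, ← dist_eq_norm, dist_comm, dist_comm v]
      have := dist_add_dist_of_mem_segment hx
      linarith [dist_nonneg (x := x) (y := v)])
    (left_mem_segment ℝ u v) (right_mem_segment ℝ u v)
  refine this.trans (le_of_eq ?_)
  rw [Real.coe_toNNReal _ hT0]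
  ring

lemma core_lsc {g : ℝ × ℝ → E} (hg : ContDiff ℝ 2 g) {Λ s : ℝ} (hΛ : 0 < Λ) (hs : 0 < s)
    (hn : ∀ u ∈ Ksq, ‖g u‖ = 1)
    (hL : ∀ u ∈ Ksq, ∀ v ∈ Ksq, ‖g u - g v‖ ≤ Λ * dist u v)
    (hσ : ∀ u ∈ Ksq, ∀ v ∈ Ksq, s ^ 2 * min 1 (Λ ^ 2 * dist u v ^ 2) ≤ 1 - ⟪g u, g v⟫ ^ 2)
    {h : ℝ × ℝ → ℝ≥0∞} (hh : LowerSemicontinuous h) {M : ℝ≥0∞} (hM : ∀ x, h x ≤ M) :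
    ∃ Y : E → ℝ≥0∞, Measurable Y ∧
      (∀ ξ, (∫⁻ u in {u : ℝ × ℝ | ⟪g u, ξ⟫ = 0} ∩ Dsq, h u ∂(μH[1] : Measure (ℝ × ℝ))) ^ 2 ≤ Y ξ) ∧
      ∫⁻ ξ, Y ξ ∂(stdGaussian E) ≤
      ENNReal.ofReal (32 * C1 s) * (ENNReal.ofReal (Λ ^ 2) * (∫⁻ u in Dsq, h u) ^ 2 +
        M * ∫⁻ u in Dsq, h u) := by
  classical
  obtain ⟨T, hT⟩ := taylor_sq hg
  set d1 : ℝ × ℝ → E := fun u => fderiv ℝ g u (1, 0)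
  set d2 : ℝ × ℝ → E := fun u => fderiv ℝ g u (0, 1)
  set η : ℕ → ℝ≥0 := fun k => T * (epsk k).toNNReal with hη
  set A : ℕ → ℕ × ℕ → Set E := fun k i =>
    Aev (epsk k) (g (uc k i)) (d1 (uc k i)) (d2 (uc k i)) (η k) with hA
  set X : ℕ → E → ℝ≥0∞ := fun k ξ =>
    ∑ i ∈ Ix k, Hc h k i * ENNReal.ofReal (epsk k) * (A k i).indicator 1 ξ with hX
  have hgc : Continuous g := hg.continuous
  -- deterministic hit
  have hit : ∀ k, ∀ i ∈ Ix k, ∀ ξ : E, ({u : ℝ × ℝ | ⟪g u, ξ⟫ = 0} ∩ Qc k i).Nonempty → ξ ∈ A k i := by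
    rintro k i hi ξ ⟨v, hv, hvQ⟩
    have hu : uc k i ∈ Ksq := Dsq_subset_Ksq (Qc_subset_Dsq hi (uc_mem k i))
    have hvK : v ∈ Ksq := Dsq_subset_Ksq (Qc_subset_Dsq hi hvQ)
    have hvu : ‖v - uc k i‖ ≤ epsk k := by rw [← dist_eq_norm]; exact Qc_dist hvQ (uc_mem k i)
    have hTv := hT _ hu v hvK
    set u := uc k i
    have hdec : v - u = (v - u).1 • ((1:ℝ), (0:ℝ)) + (v - u).2 • ((0:ℝ), (1:ℝ)) := by
      ext <;> simp
    have hfd : fderiv ℝ g u (v - u) = (v - u).1 • d1 u + (v - u).2 • d2 u := by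
      conv_lhs => rw [hdec]
      rw [map_add, map_smul, map_smul]
    have hv0 : ⟪g v, ξ⟫ = 0 := hv
    have e1 : ⟪g u, ξ⟫ = -(⟪g v - g u - fderiv ℝ g u (v - u), ξ⟫ + (v - u).1 * ⟪d1 u, ξ⟫ +
        (v - u).2 * ⟪d2 u, ξ⟫) := by
      rw [hfd]
      simp only [inner_sub_left, inner_add_left, real_inner_smul_left, hv0]
      ring
    have e2 : |⟪g v - g u - fderiv ℝ g u (v - u), ξ⟫| ≤ T * epsk k ^ 2 * ‖ξ‖ := by
      refine (abs_real_inner_le_norm _ _).trans ?_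
      gcongr
      exact hTv.trans (by gcongr)
    have e3 : |(v - u).1| ≤ epsk k := (norm_fst_le (v - u)).trans hvu
    have e4 : |(v - u).2| ≤ epsk k := (norm_snd_le (v - u)).trans hvu
    simp only [hA, Aev, Set.mem_ofPred_eq, pS_apply]
    rw [e1, abs_neg]
    refine (abs_add_three _ _ _).trans ?_
    rw [abs_mul, abs_mul]
    have hηv : (η k : ℝ) = T * epsk k := by simp [hη, (epsk_pos k).le]
    rw [hηv]
    have := mul_le_mul_of_nonneg_right e3 (abs_nonneg ⟪d1 u, ξ⟫)
    have := mul_le_mul_of_nonneg_right e4 (abs_nonneg ⟪d2 u, ξ⟫)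
    linarith
  have hdet : ∀ ξ : E, (∫⁻ u in {u : ℝ × ℝ | ⟪g u, ξ⟫ = 0} ∩ Dsq, h u ∂(μH[1] : Measure (ℝ × ℝ))) ≤
      liminf (fun k => X k ξ) atTop := by
    intro ξ
    have hZ : MeasurableSet {u : ℝ × ℝ | ⟪g u, ξ⟫ = 0} :=
      (isClosed_eq (by fun_prop) (by fun_prop)).measurableSet
    refine (lineInt_le_liminf h hh hZ).trans ?_
    refine liminf_le_liminf (Eventually.of_forall fun k => ?_)
    apply Finset.sum_le_sum
    intro i hi
    gcongr
    split_ifs with hne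
    · rw [Set.indicator_of_mem (hit k i hi ξ hne)]; simp
    · exact zero_le
  have hXm : ∀ k, Measurable (X k) := by
    intro k
    apply Finset.measurable_fun_sum
    intro i _
    exact (measurable_one.indicator (measurableSet_Aev _ _ _ _ _)).const_mul _
  have hsq : ∀ ξ : E, (∫⁻ u in {u : ℝ × ℝ | ⟪g u, ξ⟫ = 0} ∩ Dsq, h u ∂(μH[1] : Measure (ℝ × ℝ))) ^ 2 ≤
      liminf (fun k => X k ξ ^ 2) atTop := by
    intro ξ
    rw [sq]
    refine (mul_le_mul' (hdet ξ) (hdet ξ)).trans ?_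
    refine ENNReal.le_liminf_mul.trans (le_of_eq ?_)
    congr 1
    ext k
    simp [sq]
  refine ⟨_, Measurable.liminf (fun k => (hXm k).pow_const 2), hsq,
    (lintegral_liminf_le fun k => (hXm k).pow_const 2).trans ?_⟩
  -- eventual bound
  have hfin : ∀ᶠ k in atTop, ∫⁻ ξ, X k ξ ^ 2 ∂(stdGaussian E) ≤
      ENNReal.ofReal (32 * C1 s) * (ENNReal.ofReal (Λ ^ 2) * (∫⁻ u in Dsq, h u) ^ 2 +
        M * ∫⁻ u in Dsq, h u) := by
    have small : ∀ (a b : ℝ), 0 < b → ∀ᶠ k in atTop, a * epsk k ≤ b := by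
      intro a b hb
      have := epsk_tendsto.const_mul a
      rw [mul_zero] at this
      filter_upwards [this.eventually (gt_mem_nhds hb)] with k hk using hk.le
    filter_upwards [small (T * (Module.finrank ℝ E + 1)) Λ hΛ, small (80 * Λ) s hs,
      small (20 * Λ) 1 one_pos, small T Λ hΛ] with k k1 k2 k3 k4
    have hε := epsk_pos k
    have hηv : (η k : ℝ) = T * epsk k := by simp [hη, (epsk_pos k).le]
    have hcorner : ∀ i ∈ Ix k, uc k i ∈ Ksq := fun i hi =>
      Dsq_subset_Ksq (Qc_subset_Dsq hi (uc_mem k i))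
    have hshift : ∀ i ∈ Ix k, ∀ e : ℝ × ℝ, e = (1, 0) ∨ e = (0, 1) →
        uc k i + epsk k • e ∈ Ksq := by
      intro i hi e he
      simp only [Ix, Finset.mem_product, Finset.mem_range] at hi
      have hb : ∀ m : ℕ, m < 2 ^ k → (0:ℝ) ≤ m * epsk k ∧ ((m:ℝ) * epsk k + epsk k) ≤ 1 := by
        intro m hm
        refine ⟨by positivity, ?_⟩
        have : (m : ℝ) + 1 ≤ 2 ^ k := by exact_mod_cast hm
        rw [epsk_eq]
        have h2 : (0 : ℝ) < 2 ^ k := by positivity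
        rw [← add_one_mul, mul_one_div, div_le_one h2]
        exact this
      obtain ⟨a1, a2⟩ := hb _ hi.1
      obtain ⟨b1, b2⟩ := hb _ hi.2
      rcases he with rfl | rfl <;> simp only [Ksq, uc, Set.mem_prod, Set.mem_Icc, Prod.fst_add,
        Prod.snd_add, Prod.smul_fst, Prod.smul_snd, smul_eq_mul] <;>
        refine ⟨⟨?_, ?_⟩, ?_, ?_⟩ <;> linarith
    have hdn : ∀ i ∈ Ix k, ∀ e : ℝ × ℝ, e = (1, 0) ∨ e = (0, 1) →
        ‖fderiv ℝ g (uc k i) e‖ ≤ 2 * Λ := by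
      intro i hi e he
      have hen : ‖e‖ = 1 := by rcases he with rfl | rfl <;> simp [Prod.norm_def]
      have q1 := hT _ (hcorner i hi) _ (hshift i hi e he)
      have q2 := hL _ (hshift i hi e he) _ (hcorner i hi)
      rw [dist_eq_norm] at q2
      rw [add_sub_cancel_left, norm_smul, hen, mul_one, Real.norm_of_nonneg hε.le] at q1 q2
      rw [map_smul] at q1
      have q3 : ‖epsk k • fderiv ℝ g (uc k i) e‖ ≤ T * epsk k ^ 2 + Λ * epsk k := by
        have := norm_sub_le (g (uc k i + epsk k • e) - g (uc k i))
          (g (uc k i + epsk k • e) - g (uc k i) - epsk k • fderiv ℝ g (uc k i) e)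
        rw [sub_sub_cancel] at this
        linarith
      rw [norm_smul, Real.norm_of_nonneg hε.le] at q3
      have q4 : T * epsk k ^ 2 ≤ Λ * epsk k := by nlinarith
      have : epsk k * ‖fderiv ℝ g (uc k i) e‖ ≤ epsk k * (2 * Λ) := by linarith
      exact le_of_mul_le_mul_left this hε
    set J : ℕ := ⌊1 / (Λ * epsk k)⌋₊ with hJ
    have hexp : ∫⁻ ξ, X k ξ ^ 2 ∂(stdGaussian E) = ∑ i ∈ Ix k, ∑ j ∈ Ix k,
        (Hc h k i * ENNReal.ofReal (epsk k)) * (Hc h k j * ENNReal.ofReal (epsk k)) *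
          stdGaussian E (A k i ∩ A k j) := by
      have : ∀ ξ : E, X k ξ ^ 2 = ∑ i ∈ Ix k, ∑ j ∈ Ix k,
        (Hc h k i * ENNReal.ofReal (epsk k)) * (Hc h k j * ENNReal.ofReal (epsk k)) *
          (A k i ∩ A k j).indicator 1 ξ := by
        intro ξ
        simp only [hX]
        rw [sq, Finset.sum_mul_sum]
        apply Finset.sum_congr rfl; intro i _
        apply Finset.sum_congr rfl; intro j _
        rw [Set.inter_indicator_one, Pi.mul_apply]
        ring
      simp_rw [this]
      have mm : ∀ i j, Measurable ((A k i ∩ A k j).indicator (1 : E → ℝ≥0∞)) := fun i j =>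
        measurable_one.indicator ((measurableSet_Aev _ _ _ _ _).inter (measurableSet_Aev _ _ _ _ _))
      rw [lintegral_finsetSum _ (fun i _ => Finset.measurable_fun_sum _
        (fun j _ => (mm i j).const_mul _))]
      apply Finset.sum_congr rfl; intro i _
      rw [lintegral_finsetSum _ (fun j _ => (mm i j).const_mul _)]
      apply Finset.sum_congr rfl; intro j _
      rw [lintegral_const_mul _ (mm i j), lintegral_indicator_one
        ((measurableSet_Aev _ _ _ _ _).inter (measurableSet_Aev _ _ _ _ _))]
    rw [hexp]
    apply pair_sum_bound (Ix k) (Hc h k) (fun i j => stdGaussian E (A k i ∩ A k j))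
      (fun i j => if rd i j ≤ J then 1 / ((rd i j : ℝ) + 1) else 0) hΛ hε
      (by unfold C1; positivity)
    · intro i
      exact (iInf₂_le (uc k i) (uc_mem k i)).trans (hM _)
    · intro i j
      split_ifs <;> positivity
    · intro i hi j hj
      have hab := hσ _ (hcorner i hi) _ (hcorner j hj)
      rw [dist_uc] at hab
      exact pair_bound hΛ hε hs (hn _ (hcorner i hi)) (hn _ (hcorner j hj))
        (hdn i hi _ (Or.inl rfl)) (hdn i hi _ (Or.inr rfl))
        (hdn j hj _ (Or.inl rfl)) (hdn j hj _ (Or.inr rfl))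
        (by rw [hηv]; linarith) (rd i j) J hab (by linarith) (by linarith) hJ
    · intro i hi
      have := lattice_sum (2 ^ k) J i
      have hJle : (J : ℝ) ≤ 1 / (Λ * epsk k) := Nat.floor_le (by positivity)
      have hp : 0 < Λ * epsk k := by positivity
      rw [le_div_iff₀ hp] at hJle
      have := mul_le_mul_of_nonneg_left this hp.le
      rw [Ix]
      linarith
    · exact sum_Hc_le h k
  exact (liminf_le_liminf hfin).trans (liminf_const _).le

theorem core {g : ℝ × ℝ → E} (hg : ContDiff ℝ 2 g) {Λ s : ℝ} (hΛ : 0 < Λ) (hs : 0 < s)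
    (hn : ∀ u ∈ Ksq, ‖g u‖ = 1)
    (hL : ∀ u ∈ Ksq, ∀ v ∈ Ksq, ‖g u - g v‖ ≤ Λ * dist u v)
    (hσ : ∀ u ∈ Ksq, ∀ v ∈ Ksq, s ^ 2 * min 1 (Λ ^ 2 * dist u v ^ 2) ≤ 1 - ⟪g u, g v⟫ ^ 2)
    {h : ℝ × ℝ → ℝ≥0∞} (hh : Measurable h) {M : ℝ≥0∞} (hMt : M ≠ ⊤) (hM : ∀ x, h x ≤ M) :
    ∃ Y : E → ℝ≥0∞, Measurable Y ∧
      (∀ ξ, (∫⁻ u in {u : ℝ × ℝ | ⟪g u, ξ⟫ = 0} ∩ Dsq, h u ∂(μH[1] : Measure (ℝ × ℝ))) ^ 2 ≤ Y ξ) ∧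
      ∫⁻ ξ, Y ξ ∂(stdGaussian E) ≤
      ENNReal.ofReal (32 * C1 s) * (ENNReal.ofReal (Λ ^ 2) * (∫⁻ u in Dsq, h u) ^ 2 +
        M * ∫⁻ u in Dsq, h u) := by
  have hvD : volume Dsq = 1 := by
    unfold Dsq
    rw [Measure.volume_eq_prod, Measure.prod_prod]; simp
  have : IsFiniteMeasure ((volume : Measure (ℝ × ℝ)).restrict Dsq) := ⟨by simp [hvD]⟩
  set A := ∫⁻ u in Dsq, h u with hA
  have hAt : A ≠ ⊤ := by
    have : A ≤ ∫⁻ u in Dsq, M := lintegral_mono fun x => hM x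
    rw [setLIntegral_const, hvD, mul_one] at this
    exact ne_top_of_le_ne_top hMt this
  have key : ∀ δ : ℝ≥0∞, δ ≠ 0 → ∃ Y : E → ℝ≥0∞, Measurable Y ∧
      (∀ ξ, (∫⁻ u in {u : ℝ × ℝ | ⟪g u, ξ⟫ = 0} ∩ Dsq, h u ∂(μH[1] : Measure (ℝ × ℝ))) ^ 2 ≤ Y ξ) ∧
      ∫⁻ ξ, Y ξ ∂(stdGaussian E) ≤
      ENNReal.ofReal (32 * C1 s) * (ENNReal.ofReal (Λ ^ 2) * (A + δ) ^ 2 + M * (A + δ)) := by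
    intro δ hδ
    obtain ⟨h', hle, hlsc, hinteg⟩ := exists_le_lowerSemicontinuous_lintegral_ge
      ((volume : Measure (ℝ × ℝ)).restrict Dsq) h hh hδ
    set h'' : ℝ × ℝ → ℝ≥0∞ := fun x => min (h' x) M with hh''
    have hlsc' : LowerSemicontinuous h'' := hlsc.inf lowerSemicontinuous_const
    have hle' : ∀ x, h x ≤ h'' x := fun x => le_min (hle x) (hM x)
    have hA' : ∫⁻ u in Dsq, h'' u ≤ A + δ :=
      (lintegral_mono fun x => min_le_left _ _).trans hinteg
    obtain ⟨Y, hY1, hY2, hY3⟩ :=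
      core_lsc hg hΛ hs hn hL hσ hlsc' (M := M) (fun x => min_le_right _ _)
    refine ⟨Y, hY1, fun ξ => le_trans ?_ (hY2 ξ), hY3.trans ?_⟩
    · gcongr with u
      exact hle' u
    · gcongr
  have htend : Tendsto (fun δ : ℝ≥0∞ => ENNReal.ofReal (32 * C1 s) *
      (ENNReal.ofReal (Λ ^ 2) * (A + δ) ^ 2 + M * (A + δ))) (nhdsWithin 0 (Set.Ioi 0))
      (nhds (ENNReal.ofReal (32 * C1 s) * (ENNReal.ofReal (Λ ^ 2) * A ^ 2 + M * A))) := by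
    have h0 : Tendsto (fun δ : ℝ≥0∞ => A + δ) (nhdsWithin 0 (Set.Ioi 0)) (nhds A) := by
      have : Tendsto (fun δ : ℝ≥0∞ => A + δ) (nhds 0) (nhds (A + 0)) :=
        tendsto_const_nhds.add tendsto_id
      rw [add_zero] at this
      exact this.mono_left nhdsWithin_le_nhds
    refine ENNReal.Tendsto.const_mul (Tendsto.add ?_ ?_) (Or.inr ENNReal.ofReal_ne_top)
    · exact ENNReal.Tendsto.const_mul (ENNReal.Tendsto.pow h0) (Or.inr ENNReal.ofReal_ne_top)
    · exact ENNReal.Tendsto.const_mul h0 (Or.inr hMt)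
  have hδ0 : ∀ j : ℕ, ((j : ℝ≥0∞) + 1)⁻¹ ≠ 0 := fun j => by
    simp [ENNReal.inv_eq_zero]
  choose Y hY1 hY2 hY3 using fun j : ℕ => key _ (hδ0 j)
  refine ⟨fun ξ => ⨅ j, Y j ξ, Measurable.iInf hY1, fun ξ => le_iInf fun j => hY2 j ξ, ?_⟩
  have hseq : Tendsto (fun j : ℕ => ((j : ℝ≥0∞) + 1)⁻¹) atTop (nhdsWithin 0 (Set.Ioi 0)) := by
    rw [tendsto_nhdsWithin_iff]
    constructor
    · have := ENNReal.tendsto_inv_nat_nhds_zero.comp (tendsto_add_atTop_nat 1)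
      refine this.congr fun j => ?_
      simp
    · exact Eventually.of_forall fun j => pos_iff_ne_zero.2 (hδ0 j)
  refine ge_of_tendsto (htend.comp hseq) (Eventually.of_forall fun j => ?_)
  exact (lintegral_mono fun ξ => iInf_le _ j).trans (hY3 j)

end core

/-! ### Part E: finite-dimensional representation -/

section repr

variable {Ω : Type} [MeasureSpace Ω] {n : ℕ} {f : Ω → S2 → ℝ}

lemma rsh_comb (hf : IsRandomSphericalHarmonic n f) (c : S2 →₀ ℝ) :
    ∃ v : ℝ≥0, Measure.map (fun ω => Finsupp.linearCombination ℝ (f ω) c) volume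
      = gaussianReal 0 v := by
  obtain ⟨-, -, h, -⟩ := hf
  set k := c.support.card
  let eq : Fin k ≃ c.support := c.support.equivFin.symm
  obtain ⟨v, hv⟩ := h k (fun i => (eq i).1) (fun i => c (eq i).1)
  refine ⟨v, ?_⟩
  rw [← hv]
  congr 1
  ext ω
  rw [Finsupp.linearCombination_apply, Finsupp.sum, ← Finset.sum_coe_sort]
  exact (Equiv.sum_comp eq (fun a : c.support => c a.1 * f ω a.1)).symm

lemma rsh_comb_ae (hf : IsRandomSphericalHarmonic n f) (c : S2 →₀ ℝ) :
    AEMeasurable (fun ω => Finsupp.linearCombination ℝ (f ω) c) := by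
  obtain ⟨v, hv⟩ := rsh_comb hf c
  by_contra hn
  rw [Measure.map_of_not_aemeasurable hn] at hv
  exact (IsProbabilityMeasure.ne_zero (gaussianReal 0 v)) hv.symm

lemma rsh_comb_memLp (hf : IsRandomSphericalHarmonic n f) (c : S2 →₀ ℝ) :
    MemLp (fun ω => Finsupp.linearCombination ℝ (f ω) c) 2 (volume : Measure Ω) := by
  obtain ⟨v, hv⟩ := rsh_comb hf c
  have h := memLp_id_gaussianReal (μ := 0) (v := v) 2
  have h2 := rsh_comb_ae hf c
  rw [← hv] at h
  exact (memLp_map_measure_iff (by fun_prop) h2).1 h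

lemma rsh_memLp (hf : IsRandomSphericalHarmonic n f) (x : S2) :
    MemLp (fun ω => f ω x) 2 (volume : Measure Ω) := by
  have := rsh_comb_memLp hf (Finsupp.single x 1)
  simpa [Finsupp.linearCombination_single] using this

/-- class of `f(x)` in `L²` -/
def Fcl (hf : IsRandomSphericalHarmonic n f) (x : S2) : Lp ℝ 2 (volume : Measure Ω) :=
  (rsh_memLp hf x).toLp _

lemma Fcl_lc (hf : IsRandomSphericalHarmonic n f) (c : S2 →₀ ℝ) :
    (Finsupp.linearCombination ℝ (Fcl hf) c : Lp ℝ 2 (volume : Measure Ω)) =ᵐ[volume]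
      fun ω => Finsupp.linearCombination ℝ (f ω) c := by
  induction c using Finsupp.induction_linear with
  | zero =>
    rw [map_zero]
    filter_upwards [Lp.coeFn_zero ℝ 2 (volume : Measure Ω)] with ω h
    rw [h, map_zero]; rfl
  | add a b ha hb =>
    rw [map_add]
    filter_upwards [ha, hb, Lp.coeFn_add (Finsupp.linearCombination ℝ (Fcl hf) a)
      (Finsupp.linearCombination ℝ (Fcl hf) b)] with ω h1 h2 h3
    rw [h3, Pi.add_apply, h1, h2, map_add]
  | single x r =>
    rw [Finsupp.linearCombination_single]
    filter_upwards [Lp.coeFn_smul r (Fcl hf x), (rsh_memLp hf x).coeFn_toLp] with ω h1 h2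
    rw [h1, Pi.smul_apply, Finsupp.linearCombination_single, Fcl, h2]

lemma Fcl_inner (hf : IsRandomSphericalHarmonic n f) (x y : S2) :
    ⟪Fcl hf x, Fcl hf y⟫ = Pl n ⟪(x : E3), (y : E3)⟫ := by
  rw [← hf.2.2.2 x y, L2.inner_def]
  apply integral_congr_ae
  filter_upwards [(rsh_memLp hf x).coeFn_toLp, (rsh_memLp hf y).coeFn_toLp] with ω h1 h2
  rw [Fcl, Fcl, h1, h2]
  simp [mul_comm]

lemma rsh_variance (hf : IsRandomSphericalHarmonic n f) (c : S2 →₀ ℝ) :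
    Measure.map (fun ω => Finsupp.linearCombination ℝ (f ω) c) volume
      = gaussianReal 0 (‖Finsupp.linearCombination ℝ (Fcl hf) c‖₊ ^ 2) := by
  obtain ⟨v, hv⟩ := rsh_comb hf c
  rw [hv]
  congr 1
  have hm := rsh_comb_ae hf c
  have h1 : ∫ x, x ^ 2 ∂(gaussianReal 0 v) = v := by
    have := variance_fun_id_gaussianReal (μ := 0) (v := v)
    rw [variance_of_integral_eq_zero (by fun_prop) (by simp)] at this
    exact this
  rw [← hv, integral_map hm (by fun_prop)] at h1
  have h2 : ⟪Finsupp.linearCombination ℝ (Fcl hf) c, Finsupp.linearCombination ℝ (Fcl hf) c⟫ =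
      (v : ℝ) := by
    rw [← h1, L2.inner_def]
    apply integral_congr_ae
    filter_upwards [Fcl_lc hf c] with ω h
    rw [h]
    simp [sq]
  rw [real_inner_self_eq_norm_sq] at h2
  apply NNReal.coe_injective
  rw [← h2]
  simp

lemma Fcl_finiteDim (hf : IsRandomSphericalHarmonic n f) :
    FiniteDimensional ℝ (Submodule.span ℝ (Set.range (Fcl hf))) := by
  set V := Submodule.span ℝ (Set.range (Fcl hf)) with hV
  set d := (legendreP n).natDegree with hd
  let T : Lp ℝ 2 (volume : Measure Ω) →ₗ[ℝ] (S2 → ℝ) :=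
    LinearMap.pi fun y => (innerₗ (Lp ℝ 2 (volume : Measure Ω))) (Fcl hf y)
  let mon : (Σ k : Fin (d + 1), (Fin k → Fin 3)) → (S2 → ℝ) := fun q y => ∏ i, (y : E3) (q.2 i)
  set W := Submodule.span ℝ (Set.range mon)
  have hWfin : FiniteDimensional ℝ W := FiniteDimensional.span_of_finite ℝ (Set.finite_range mon)
  have hTF : ∀ x, T (Fcl hf x) ∈ W := by
    intro x
    have : T (Fcl hf x) = ∑ k : Fin (d + 1), ∑ p : Fin k → Fin 3,
        ((legendreP n).coeff k * ∏ i, (x : E3) (p i)) • mon ⟨k, p⟩ := by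
      ext y
      simp only [T, LinearMap.pi_apply, innerₗ_apply_apply, Fcl_inner, Finset.sum_apply,
        Pi.smul_apply, smul_eq_mul, mon]
      rw [Pl, Polynomial.eval_eq_sum_range, ← Fin.sum_univ_eq_sum_range
        (fun k => (legendreP n).coeff k * ⟪(y : E3), (x : E3)⟫ ^ k)]
      apply Finset.sum_congr rfl
      intro k _
      have : ⟪(y : E3), (x : E3)⟫ = ∑ i, (x : E3) i * (y : E3) i := by
        rw [PiLp.inner_apply]; simp
      rw [this, Fintype.sum_pow, Finset.mul_sum]
      apply Finset.sum_congr rfl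
      intro p _
      rw [Finset.prod_mul_distrib]
      ring
    rw [this]
    exact Submodule.sum_mem _ fun k _ => Submodule.sum_mem _ fun p _ =>
      Submodule.smul_mem _ _ (Submodule.subset_span ⟨_, rfl⟩)
  have hTV : ∀ v ∈ V, T v ∈ W := by
    intro v hv
    have : V ≤ W.comap T := by
      rw [hV, Submodule.span_le]
      rintro _ ⟨x, rfl⟩
      exact hTF x
    exact this hv
  let T' : V →ₗ[ℝ] W := (T.comp V.subtype).codRestrict W (fun v => hTV v.1 v.2)
  apply FiniteDimensional.of_injective T'
  rw [← LinearMap.ker_eq_bot, LinearMap.ker_eq_bot']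
  intro v hv
  have h0 : T v.1 = 0 := by
    exact congrArg Subtype.val hv
  have h1 : ∀ w ∈ V, ⟪w, v.1⟫ = 0 := by
    intro w hw
    induction hw using Submodule.span_induction with
    | mem x hx =>
      obtain ⟨y, rfl⟩ := hx
      exact congrFun h0 y
    | zero => simp
    | add a b _ _ ha hb => rw [inner_add_left, ha, hb, add_zero]
    | smul r a _ ha => rw [real_inner_smul_left, ha, mul_zero]
  have := h1 v.1 v.2
  rw [inner_self_eq_zero] at this
  exact Subtype.ext this

set_option maxHeartbeats 1000000 in
theorem rsh_repr (hf : IsRandomSphericalHarmonic n f) :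
    ∃ (m : ℕ) (e : E3 → EuclideanSpace ℝ (Fin m)) (ξ : Ω → EuclideanSpace ℝ (Fin m)),
      ContDiff ℝ 2 e ∧ (∀ x y : S2, ⟪e x, e y⟫ = Pl n ⟪(x : E3), (y : E3)⟫) ∧
      AEMeasurable ξ ∧ Measure.map ξ volume = stdGaussian (EuclideanSpace ℝ (Fin m)) ∧
      ∀ᵐ ω, ∀ x : S2, f ω x = ⟪e x, ξ ω⟫ := by
  have hprob : IsProbabilityMeasure (volume : Measure Ω) := hf.1
  set V := Submodule.span ℝ (Set.range (Fcl hf)) with hV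
  have : FiniteDimensional ℝ V := Fcl_finiteDim hf
  set m := Module.finrank ℝ V
  let b : OrthonormalBasis (Fin m) ℝ V := stdOrthonormalBasis ℝ V
  have hb : ∀ i, ∃ c : S2 →₀ ℝ, Finsupp.linearCombination ℝ (Fcl hf) c = (b i : Lp ℝ 2 (volume : Measure Ω)) :=
    fun i => (Finsupp.mem_span_range_iff_exists_finsupp.1 (b i).2)
  choose c hc using hb
  let FV : S2 → V := fun x => ⟨Fcl hf x, Submodule.subset_span ⟨x, rfl⟩⟩
  let e : E3 → EuclideanSpace ℝ (Fin m) := fun y =>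
    WithLp.toLp 2 fun i => (c i).sum fun a r => r * Pl n ⟪(a : E3), y⟫
  let ξ : Ω → EuclideanSpace ℝ (Fin m) := fun ω =>
    WithLp.toLp 2 fun i => Finsupp.linearCombination ℝ (f ω) (c i)
  have he : ∀ (x : S2) i, e x i = ⟪b i, FV x⟫ := by
    intro x i
    change (c i).sum (fun a r => r * Pl n ⟪(a : E3), (x : E3)⟫) = ⟪(b i : Lp ℝ 2 (volume : Measure Ω)), Fcl hf x⟫
    rw [← hc i, Finsupp.linearCombination_apply, Finsupp.sum, Finsupp.sum, sum_inner]
    apply Finset.sum_congr rfl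
    intro a _
    rw [real_inner_smul_left, Fcl_inner]
  have hξc : ∀ (t : EuclideanSpace ℝ (Fin m)) ω, ⟪t, ξ ω⟫ =
      Finsupp.linearCombination ℝ (f ω) (∑ i, t i • c i) := by
    intro t ω
    rw [PiLp.inner_apply, map_sum]
    apply Finset.sum_congr rfl
    intro i _
    simp [ξ, mul_comm]
  have hξm : AEMeasurable ξ := by
    have : AEMeasurable (fun ω => fun i => Finsupp.linearCombination ℝ (f ω) (c i)) :=
      aemeasurable_pi_lambda _ fun i => rsh_comb_ae hf (c i)
    exact (WithLp.measurable_toLp 2 (Fin m → ℝ)).comp_aemeasurable this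
  have hcont : ContDiff ℝ 2 e := by
    have hP : ContDiff ℝ 2 (Pl n) := (legendreP n).contDiff_aeval 2
    rw [contDiff_euclidean]
    intro i
    change ContDiff ℝ 2 fun y : E3 => ∑ a ∈ (c i).support, (c i a) * Pl n ⟪(a : E3), y⟫
    apply ContDiff.sum
    intro a _
    exact contDiff_const.mul (hP.comp (contDiff_const.inner ℝ contDiff_id))
  refine ⟨m, e, ξ, hcont, ?_, hξm, ?_, ?_⟩
  · intro x y
    rw [← Fcl_inner hf x y, PiLp.inner_apply]
    have := b.sum_inner_mul_inner (FV x) (FV y)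
    have h3 : ⟪FV x, FV y⟫ = ⟪Fcl hf x, Fcl hf y⟫ := rfl
    rw [← h3, ← this]
    apply Finset.sum_congr rfl
    intro i _
    rw [he, he, real_inner_comm (b i) (FV x)]
    exact mul_comm _ _
  · have : IsProbabilityMeasure (Measure.map ξ volume) := Measure.isProbabilityMeasure_map hξm
    apply Measure.ext_of_charFun
    ext t
    rw [charFun_stdGaussian]
    have h1 := rsh_variance hf (∑ i, t i • c i)
    have h2 : ‖Finsupp.linearCombination ℝ (Fcl hf) (∑ i, t i • c i)‖ ^ 2 = ‖t‖ ^ 2 := by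
      have : Finsupp.linearCombination ℝ (Fcl hf) (∑ i, t i • c i) =
          ((b.repr.symm t : V) : Lp ℝ 2 (volume : Measure Ω)) := by
        rw [map_sum, ← b.sum_repr_symm t, Submodule.coe_sum]
        apply Finset.sum_congr rfl
        intro i _
        rw [map_smul, hc, Submodule.coe_smul]
      rw [this, ← Submodule.coe_norm, LinearIsometryEquiv.norm_map]
    have h3 : charFun (Measure.map ξ volume) t =
        charFun (Measure.map (fun ω => Finsupp.linearCombination ℝ (f ω) (∑ i, t i • c i)) volume) 1 := by
      rw [charFun_apply, charFun_apply, integral_map hξm (by fun_prop),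
        integral_map (rsh_comb_ae hf _) (by fun_prop)]
      congr 1
      ext ω
      rw [real_inner_comm, hξc]
      simp
    rw [h3, h1, charFun_gaussianReal]
    have h4 : (((‖Finsupp.linearCombination ℝ (Fcl hf) (∑ i, t i • c i)‖₊ ^ 2 : ℝ≥0) : ℝ) : ℂ) =
        ((‖t‖ ^ 2 : ℝ) : ℂ) := by
      rw [← h2]; simp
    rw [h4]
    push_cast
    congr 1
    ring
  · obtain ⟨s, hsc, hsd⟩ := TopologicalSpace.exists_countable_dense S2
    have hx : ∀ x : S2, ∀ᵐ ω, f ω x = ⟪e x, ξ ω⟫ := by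
      intro x
      have h0 : Finsupp.linearCombination ℝ (Fcl hf) (Finsupp.single x 1 - ∑ i, (e x) i • c i) = 0 := by
        rw [map_sub, map_sum, Finsupp.linearCombination_single, one_smul, sub_eq_zero]
        have := congrArg Subtype.val (b.sum_repr' (FV x))
        rw [Submodule.coe_sum] at this
        rw [show Fcl hf x = (FV x).1 from rfl, ← this]
        apply Finset.sum_congr rfl
        intro i _
        rw [map_smul, hc, Submodule.coe_smul, he]
      have h1 := Fcl_lc hf (Finsupp.single x 1 - ∑ i, (e x) i • c i)
      rw [h0] at h1
      filter_upwards [h1, Lp.coeFn_zero ℝ 2 (volume : Measure Ω)] with ω h2 h3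
      rw [h3, map_sub, Finsupp.linearCombination_single, ← hξc] at h2
      simp only [Pi.zero_apply, smul_eq_mul, one_mul] at h2
      linarith
    filter_upwards [(ae_ball_iff hsc).2 fun x _ => hx x] with ω hω
    have hc1 : Continuous (f ω) := hf.2.1 ω
    have hc2 : Continuous fun x : S2 => ⟪e x, ξ ω⟫ := by
      have := hcont.continuous
      fun_prop
    exact fun x => congrFun (Continuous.ext_on hsd hc1 hc2 hω) x

end repr

/-! ### Part F: charts -/

/-- Radial projection chart. -/
def qv (u : ℝ × ℝ) : E3 := !₂[u.1 - 1/2, u.2 - 1/2, 1]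

def chart0 (u : ℝ × ℝ) : E3 := (√(1 + (u.1 - 1/2)^2 + (u.2 - 1/2)^2))⁻¹ • qv u

lemma inner_qv (u v : ℝ × ℝ) :
    ⟪qv u, qv v⟫ = 1 + (u.1 - 1/2) * (v.1 - 1/2) + (u.2 - 1/2) * (v.2 - 1/2) := by
  simp [qv, EuclideanSpace.inner_eq_star_dotProduct, Fin.sum_univ_three, dotProduct]
  ring

lemma norm_chart0 (u : ℝ × ℝ) : ‖chart0 u‖ = 1 := by
  have h : ‖qv u‖ = √(1 + (u.1 - 1/2)^2 + (u.2 - 1/2)^2) := by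
    rw [← Real.sqrt_sq (norm_nonneg (qv u)), ← real_inner_self_eq_norm_sq, inner_qv]
    congr 1; ring
  have hp : 0 < √(1 + (u.1 - 1/2)^2 + (u.2 - 1/2)^2) := Real.sqrt_pos.2 (by positivity)
  rw [chart0, norm_smul, h, Real.norm_eq_abs, abs_of_pos (inv_pos.2 hp), inv_mul_cancel₀ hp.ne']

lemma contDiff_chart0 : ContDiff ℝ 2 chart0 := by
  unfold chart0
  refine ContDiff.smul (ContDiff.inv (ContDiff.sqrt (by fun_prop) ?_) ?_) ?_
  · intro x; positivity
  · intro x; exact (Real.sqrt_pos.2 (by positivity)).ne'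
  · rw [contDiff_euclidean]
    intro i
    fin_cases i <;> simp [qv] <;> fun_prop

lemma inner_chart0 (u v : ℝ × ℝ) : ⟪chart0 u, chart0 v⟫ =
    (1 + (u.1 - 1/2) * (v.1 - 1/2) + (u.2 - 1/2) * (v.2 - 1/2)) /
      (√(1 + (u.1 - 1/2)^2 + (u.2 - 1/2)^2) * √(1 + (v.1 - 1/2)^2 + (v.2 - 1/2)^2)) := by
  rw [chart0, chart0, real_inner_smul_left, real_inner_smul_right, inner_qv]
  field_simp

lemma dist_prod_sq (u v : ℝ × ℝ) : dist u v ^ 2 ≤ (u.1 - v.1)^2 + (u.2 - v.2)^2 ∧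
    (u.1 - v.1)^2 ≤ dist u v ^ 2 ∧ (u.2 - v.2)^2 ≤ dist u v ^ 2 := by
  rw [Prod.dist_eq, Real.dist_eq, Real.dist_eq]
  rw [← sq_abs (u.1 - v.1), ← sq_abs (u.2 - v.2)]
  have h1 := abs_nonneg (u.1 - v.1)
  have h2 := abs_nonneg (u.2 - v.2)
  rcases le_total |u.1 - v.1| |u.2 - v.2| with h | h
  · rw [max_eq_right h]; exact ⟨by nlinarith, by nlinarith, le_rfl⟩
  · rw [max_eq_left h]; exact ⟨by nlinarith, le_rfl, by nlinarith⟩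

lemma alg_bound {a b a' b' d : ℝ} (ha : |a| ≤ 1/2) (hb : |b| ≤ 1/2) (ha' : |a'| ≤ 1/2)
    (hb' : |b'| ≤ 1/2) (h0 : d^2 ≤ (a-a')^2 + (b-b')^2) (h1 : (a-a')^2 ≤ d^2)
    (h2 : (b-b')^2 ≤ d^2) {c : ℝ}
    (hc : c = (1 + a*a' + b*b') / (√(1+a^2+b^2) * √(1+a'^2+b'^2))) :
    0 ≤ c ∧ c ≤ 1 ∧ 2/9 * d^2 ≤ 1 - c ∧ 1 - c ≤ 3 * d^2 := by
  rw [abs_le] at ha hb ha' hb'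
  have hsq : ∀ x : ℝ, -(1/2) ≤ x ∧ x ≤ 1/2 → x^2 ≤ 1/4 := fun x hx => by
    nlinarith [mul_nonneg (sub_nonneg.2 hx.1) (sub_nonneg.2 hx.2)]
  have sa := hsq a ha
  have sb := hsq b hb
  have sa' := hsq a' ha'
  have sb' := hsq b' hb'
  clear hsq ha hb ha' hb'
  have hI : 0 ≤ 1 + a*a' + b*b' := by
    have e1 : (a+a')^2 = a^2 + 2*(a*a') + a'^2 := by ring
    have e2 : (b+b')^2 = b^2 + 2*(b*b') + b'^2 := by ring
    linarith [sq_nonneg (a+a'), sq_nonneg (b+b')]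
  have hc0 : 0 ≤ c := by rw [hc]; positivity
  have hX1 : 1 ≤ 1+a^2+b^2 := by linarith [sq_nonneg a, sq_nonneg b]
  have hY1 : 1 ≤ 1+a'^2+b'^2 := by linarith [sq_nonneg a', sq_nonneg b']
  have hX2 : 1+a^2+b^2 ≤ 3/2 := by linarith
  have hY2 : 1+a'^2+b'^2 ≤ 3/2 := by linarith
  obtain ⟨X, hX⟩ : ∃ X, X = 1+a^2+b^2 := ⟨_, rfl⟩
  obtain ⟨Y, hY⟩ : ∃ Y, Y = 1+a'^2+b'^2 := ⟨_, rfl⟩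
  rw [← hX] at hX1 hX2 hc
  rw [← hY] at hY1 hY2 hc
  have hXY1 : 1 ≤ X * Y := one_le_mul_of_one_le_of_one_le hX1 hY1
  have hXY2 : X * Y ≤ 9/4 := by
    calc X * Y ≤ 3/2 * (3/2) := mul_le_mul hX2 hY2 (by linarith) (by norm_num)
      _ = _ := by norm_num
  have hcs : c^2 * (X*Y) = (1 + a*a' + b*b')^2 := by
    rw [hc, div_pow, mul_pow, Real.sq_sqrt (by linarith), Real.sq_sqrt (by linarith)]
    field_simp
  have hlag : X*Y - (1 + a*a' + b*b')^2 = (a-a')^2 + (b-b')^2 + (a*(b'-b) - b*(a'-a))^2 := by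
    rw [hX, hY]; ring
  have hcross : (a*(b'-b) - b*(a'-a))^2 ≤ d^2 := by
    have : (a*(b'-b) - b*(a'-a))^2 ≤ (a^2+b^2) * ((a-a')^2 + (b-b')^2) := by
      nlinarith [sq_nonneg (a*(a'-a) + b*(b'-b))]
    have h3 : (a^2+b^2) * ((a-a')^2 + (b-b')^2) ≤ 1/2 * ((a-a')^2 + (b-b')^2) :=
      mul_le_mul_of_nonneg_right (by linarith) (by positivity)
    linarith
  have hdef : (1 - c^2) * (X*Y) = (a-a')^2 + (b-b')^2 + (a*(b'-b) - b*(a'-a))^2 := by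
    rw [← hlag, ← hcs]; ring
  have hnn : 0 ≤ 1 - c^2 := by
    by_contra h
    push Not at h
    have : (1 - c^2) * (X*Y) < 0 := mul_neg_of_neg_of_pos h (by linarith)
    rw [hdef] at this
    have : 0 ≤ (a-a')^2 + (b-b')^2 + (a*(b'-b) - b*(a'-a))^2 := by positivity
    linarith
  have hc1 : c ≤ 1 := by
    rw [← abs_of_nonneg hc0]; exact abs_le_one_iff_mul_self_le_one.2 (by linarith [sq c])
  have hlow : 4/9 * d^2 ≤ 1 - c^2 := by
    have : d^2 ≤ (1 - c^2) * (9/4) := by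
      calc d^2 ≤ (1-c^2) * (X*Y) := by
            rw [hdef]; linarith [sq_nonneg (a*(b'-b) - b*(a'-a))]
        _ ≤ _ := mul_le_mul_of_nonneg_left hXY2 hnn
    linarith
  have hup : 1 - c^2 ≤ 3 * d^2 := by
    calc 1 - c^2 = (1-c^2) * 1 := by ring
      _ ≤ (1-c^2) * (X*Y) := mul_le_mul_of_nonneg_left hXY1 hnn
      _ ≤ _ := by rw [hdef]; linarith
  have hf : 1 - c^2 = (1 - c) * (1 + c) := by ring
  have hf1 : (1 - c) * (1 + c) ≤ (1 - c) * 2 := mul_le_mul_of_nonneg_left (by linarith) (by linarith)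
  have hf2 : (1 - c) * 1 ≤ (1 - c) * (1 + c) := mul_le_mul_of_nonneg_left (by linarith) (by linarith)
  exact ⟨hc0, hc1, by linarith, by linarith⟩

lemma Ksq_abs {u : ℝ × ℝ} (hu : u ∈ Ksq) : |u.1 - 1/2| ≤ 1/2 ∧ |u.2 - 1/2| ≤ 1/2 := by
  obtain ⟨⟨h1, h2⟩, h3, h4⟩ := hu
  constructor <;> rw [abs_le] <;> constructor <;> linarith

lemma chart0_c {u v : ℝ × ℝ} (hu : u ∈ Ksq) (hv : v ∈ Ksq) :
    0 ≤ ⟪chart0 u, chart0 v⟫ ∧ ⟪chart0 u, chart0 v⟫ ≤ 1 ∧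
      2/9 * dist u v ^ 2 ≤ 1 - ⟪chart0 u, chart0 v⟫ ∧
      1 - ⟪chart0 u, chart0 v⟫ ≤ 3 * dist u v ^ 2 := by
  obtain ⟨h0, h1, h2⟩ := dist_prod_sq u v
  refine alg_bound (Ksq_abs hu).1 (Ksq_abs hu).2 (Ksq_abs hv).1 (Ksq_abs hv).2 ?_ ?_ ?_
    (inner_chart0 u v)
  · convert h0 using 2 <;> ring
  · convert h1 using 1; ring
  · convert h2 using 1; ring

/-- Rotated chart into the sphere. -/
def chartR (R : E3 ≃ₗᵢ[ℝ] E3) (u : ℝ × ℝ) : S2 :=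
  ⟨R (chart0 u), by rw [mem_sphere_zero_iff_norm, R.norm_map, norm_chart0]⟩

lemma inner_chartR (R : E3 ≃ₗᵢ[ℝ] E3) (u v : ℝ × ℝ) :
    ⟪(chartR R u : E3), (chartR R v : E3)⟫ = ⟪chart0 u, chart0 v⟫ := R.inner_map_map _ _

lemma continuous_chartR (R : E3 ≃ₗᵢ[ℝ] E3) : Continuous (chartR R) :=
  Continuous.subtype_mk (R.continuous.comp contDiff_chart0.continuous) _

lemma dist_chartR_sq (R : E3 ≃ₗᵢ[ℝ] E3) (u v : ℝ × ℝ) :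
    dist (chartR R u) (chartR R v) ^ 2 = 2 * (1 - ⟪chart0 u, chart0 v⟫) := by
  rw [Subtype.dist_eq, dist_eq_norm, norm_sub_sq_real, inner_chartR,
    mem_sphere_zero_iff_norm.1 (chartR R u).2, mem_sphere_zero_iff_norm.1 (chartR R v).2]
  ring

lemma chartR_lip (R : E3 ≃ₗᵢ[ℝ] E3) {u v : ℝ × ℝ} (hu : u ∈ Ksq) (hv : v ∈ Ksq) :
    dist (chartR R u) (chartR R v) ≤ 3 * dist u v := by
  refine (sq_le_sq₀ dist_nonneg (by positivity)).1 ?_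
  rw [dist_chartR_sq]
  nlinarith [(chart0_c hu hv).2.2.2, sq_nonneg (dist u v)]

lemma chartR_antilip (R : E3 ≃ₗᵢ[ℝ] E3) {u v : ℝ × ℝ} (hu : u ∈ Ksq) (hv : v ∈ Ksq) :
    dist u v ≤ 3/2 * dist (chartR R u) (chartR R v) := by
  refine (sq_le_sq₀ dist_nonneg (by positivity)).1 ?_
  rw [mul_pow, dist_chartR_sq]
  nlinarith [(chart0_c hu hv).2.2.1, sq_nonneg (dist u v)]

/-! Cover -/

def Upatch : Set E3 := {y | 0 < y 2 ∧ |y 0| < y 2 / 2 ∧ |y 1| < y 2 / 2}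

lemma isOpen_Upatch : IsOpen Upatch := by
  have h (i : Fin 3) : Continuous fun y : E3 => y i := by fun_prop
  exact (isOpen_lt continuous_const (h 2)).inter
    ((isOpen_lt (h 0).abs ((h 2).div_const 2)).inter (isOpen_lt (h 1).abs ((h 2).div_const 2)))

lemma Upatch_sub {y : E3} (hy : y ∈ Upatch) (hn : ‖y‖ = 1) : ∃ u ∈ Dsq, chart0 u = y := by
  obtain ⟨h2, h0, h1⟩ := hy
  rw [abs_lt] at h0 h1
  refine ⟨(y 0 / y 2 + 1/2, y 1 / y 2 + 1/2), ⟨⟨?_, ?_⟩, ⟨?_, ?_⟩⟩, ?_⟩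
  · have : -(1/2) ≤ y 0 / y 2 := by rw [le_div_iff₀ h2]; linarith
    simp only; linarith
  · have : y 0 / y 2 < 1/2 := by rw [div_lt_iff₀ h2]; linarith
    simp only; linarith
  · have : -(1/2) ≤ y 1 / y 2 := by rw [le_div_iff₀ h2]; linarith
    simp only; linarith
  · have : y 1 / y 2 < 1/2 := by rw [div_lt_iff₀ h2]; linarith
    simp only; linarith
  · have hs : y 0 ^ 2 + y 1 ^ 2 + y 2 ^ 2 = 1 := by
      have := EuclideanSpace.real_norm_sq_eq y
      rw [hn, Fin.sum_univ_three] at this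
      linarith
    have hq : √(1 + (y 0 / y 2 + 1/2 - 1/2)^2 + (y 1 / y 2 + 1/2 - 1/2)^2) = (y 2)⁻¹ := by
      rw [show 1 + (y 0 / y 2 + 1/2 - 1/2)^2 + (y 1 / y 2 + 1/2 - 1/2)^2 = ((y 2)⁻¹)^2 by
        field_simp; linarith]
      exact Real.sqrt_sq (inv_nonneg.2 h2.le)
    rw [chart0]
    simp only [hq, inv_inv]
    ext i
    fin_cases i <;> simp [qv] <;> field_simp

lemma exists_cover : ∃ T : Finset (E3 ≃ₗᵢ[ℝ] E3), ∀ y : S2, ∃ R ∈ T, ∃ u ∈ Dsq, chartR R u = y := by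
  classical
  let e3 : E3 := !₂[0, 0, 1]
  have he3 : ‖e3‖ = 1 := by
    simp [e3, EuclideanSpace.norm_eq, Fin.sum_univ_three]
  have heU : e3 ∈ Upatch := by simp [Upatch, e3]
  have hR (p : S2) : ∃ R : E3 ≃ₗᵢ[ℝ] E3, R e3 = p :=
    ⟨_, Submodule.reflection_sub (he3.trans (mem_sphere_zero_iff_norm.1 p.2).symm)⟩
  choose R hR using hR
  have hopen (p : S2) : IsOpen {y : S2 | (R p).symm y ∈ Upatch} :=
    isOpen_Upatch.preimage ((R p).symm.continuous.comp continuous_subtype_val)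
  obtain ⟨t, ht⟩ := isCompact_univ.elim_finite_subcover (fun p : S2 => {y : S2 | (R p).symm y ∈ Upatch})
    hopen (fun p _ => Set.mem_iUnion.2 ⟨p, by
      change (R p).symm p ∈ Upatch
      rw [← hR p, LinearIsometryEquiv.symm_apply_apply]; exact heU⟩)
  refine ⟨t.image R, fun y => ?_⟩
  obtain ⟨p, hp⟩ := Set.mem_iUnion.1 (ht (Set.mem_univ y))
  obtain ⟨hpt, hyp⟩ := Set.mem_iUnion.1 hp
  obtain ⟨u, hu, hue⟩ := Upatch_sub hyp (by
    rw [LinearIsometryEquiv.norm_map]; exact mem_sphere_zero_iff_norm.1 y.2)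
  refine ⟨R p, Finset.mem_image_of_mem _ hpt, u, hu, Subtype.ext ?_⟩
  change R p (chart0 u) = y
  rw [hue, LinearIsometryEquiv.apply_symm_apply]

lemma chartR_lipOn (R : E3 ≃ₗᵢ[ℝ] E3) : LipschitzOnWith 3 (chartR R) Dsq :=
  LipschitzOnWith.of_dist_le_mul fun u hu v hv => by
    simpa using chartR_lip R (Dsq_subset_Ksq hu) (Dsq_subset_Ksq hv)

lemma chartR_injOn (R : E3 ≃ₗᵢ[ℝ] E3) : Set.InjOn (chartR R) Dsq := fun u hu v hv h => by
  have := chartR_antilip R (Dsq_subset_Ksq hu) (Dsq_subset_Ksq hv)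
  rw [h, dist_self, mul_zero] at this
  exact dist_le_zero.1 this

lemma transfer1 (R : E3 ≃ₗᵢ[ℝ] E3) : (μH[1] : Measure S2).restrict (chartR R '' Dsq) ≤
    (3 : ℝ≥0∞) • Measure.map (chartR R) ((μH[1] : Measure (ℝ × ℝ)).restrict Dsq) := by
  refine Measure.le_iff.2 fun B hB => ?_
  rw [Measure.restrict_apply hB, Measure.smul_apply,
    Measure.map_apply (continuous_chartR R).measurable hB,
    Measure.restrict_apply ((continuous_chartR R).measurable hB), smul_eq_mul,
    Set.inter_comm, ← Set.image_inter_preimage, Set.inter_comm]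
  have := ((chartR_lipOn R).mono (Set.inter_subset_right (s := chartR R ⁻¹' B))).hausdorffMeasure_image_le
    (d := 1) zero_le_one
  simpa using this

lemma transfer1_lint (R : E3 ≃ₗᵢ[ℝ] E3) {Z : Set S2} (hZ : MeasurableSet Z) {g : S2 → ℝ≥0∞}
    (hg : Measurable g) :
    ∫⁻ x in Z ∩ chartR R '' Dsq, g x ∂(μH[1] : Measure S2) ≤
      3 * ∫⁻ u in chartR R ⁻¹' Z ∩ Dsq, g (chartR R u) ∂(μH[1] : Measure (ℝ × ℝ)) := by
  have hc := (continuous_chartR R).measurable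
  rw [← Measure.restrict_restrict hZ, ← Measure.restrict_restrict (hc hZ)]
  refine (lintegral_mono' (Measure.restrict_mono le_rfl (transfer1 R)) le_rfl).trans ?_
  rw [Measure.restrict_smul, lintegral_smul_measure, setLIntegral_map hZ hg hc, smul_eq_mul]

lemma transfer2 (R : E3 ≃ₗᵢ[ℝ] E3) :
    Measure.map (chartR R) ((volume : Measure (ℝ × ℝ)).restrict Dsq) ≤ (4 : ℝ≥0∞) • sphArea := by
  refine Measure.le_iff.2 fun B hB => ?_
  have hc := (continuous_chartR R).measurable
  rw [Measure.smul_apply, Measure.map_apply hc hB, Measure.restrict_apply (hc hB), smul_eq_mul,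
    ← hausdorffMeasure_prod_real, sphArea]
  set S := chartR R ⁻¹' B ∩ Dsq
  have hS : S ⊆ Dsq := Set.inter_subset_right
  have hinj := (chartR_injOn R).mono hS
  let inv := Function.invFunOn (chartR R) S
  have hl : Set.LeftInvOn inv (chartR R) S := hinj.leftInvOn_invFunOn
  have hLip : LipschitzOnWith 2 inv (chartR R '' S) := by
    refine LipschitzOnWith.of_dist_le_mul ?_
    rintro _ ⟨u, hu, rfl⟩ _ ⟨v, hv, rfl⟩
    rw [hl hu, hl hv]
    have h1 := chartR_antilip R (Dsq_subset_Ksq (hS hu)) (Dsq_subset_Ksq (hS hv))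
    have h2 := dist_nonneg (x := chartR R u) (y := chartR R v)
    simp only [NNReal.coe_ofNat]
    linarith
  have h := hLip.hausdorffMeasure_image_le (d := 2) zero_le_two
  rw [hl.image_image] at h
  refine h.trans ?_
  have h4 : ((2 : ℝ≥0) : ℝ≥0∞) ^ (2 : ℝ) = 4 := by
    norm_num
  rw [h4]
  gcongr
  rintro _ ⟨u, hu, rfl⟩
  exact hu.1

lemma transfer2_lint (R : E3 ≃ₗᵢ[ℝ] E3) {g : S2 → ℝ≥0∞} (hg : Measurable g) :
    ∫⁻ u in Dsq, g (chartR R u) ≤ 4 * ∫⁻ x, g x ∂sphArea := by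
  have hc := (continuous_chartR R).measurable
  rw [← lintegral_map hg hc]
  refine (lintegral_mono' (transfer2 R) le_rfl).trans ?_
  rw [lintegral_smul_measure, smul_eq_mul]

lemma volume_Dsq : volume Dsq = 1 := by
  rw [Dsq, Measure.volume_eq_prod, Measure.prod_prod]; simp

lemma sphArea_lt_top : sphArea Set.univ < ⊤ := by
  obtain ⟨T, hT⟩ := exists_cover
  have hsub : (Set.univ : Set S2) ⊆ ⋃ R ∈ T, chartR R '' Dsq := fun y _ => by
    obtain ⟨R, hR, u, hu, rfl⟩ := hT y
    exact Set.mem_biUnion hR ⟨u, hu, rfl⟩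
  refine (measure_mono hsub).trans_lt ((measure_biUnion_finset_le _ _).trans_lt ?_)
  refine ENNReal.sum_lt_top.2 fun R _ => ?_
  refine ((chartR_lipOn R).hausdorffMeasure_image_le (d := 2) zero_le_two).trans_lt ?_
  rw [hausdorffMeasure_prod_real, volume_Dsq, mul_one]
  exact ENNReal.rpow_lt_top_of_nonneg zero_le_two ENNReal.coe_ne_top

instance : IsFiniteMeasure sphArea := ⟨sphArea_lt_top⟩

def CP : ℝ≥0∞ := 9 * (ENNReal.ofReal (32 * C1 (1/30)) * 192)

lemma CP_ne_top : CP ≠ ⊤ :=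
  ENNReal.mul_ne_top (by norm_num) (ENNReal.mul_ne_top ENNReal.ofReal_ne_top (by norm_num))

lemma patch_bound {n m : ℕ} (hn : 1 ≤ n) {e : E3 → EuclideanSpace ℝ (Fin m)} (he : ContDiff ℝ 2 e)
    (hP : ∀ x y : S2, ⟪e x, e y⟫ = Pl n ⟪(x:E3),(y:E3)⟫) (R : E3 ≃ₗᵢ[ℝ] E3)
    {g : S2 → ℝ≥0∞} (hg : Measurable g) {M : ℝ≥0∞} (hMt : M ≠ ⊤) (hM : ∀ x, g x ≤ M) :
    ∃ Y : EuclideanSpace ℝ (Fin m) → ℝ≥0∞, Measurable Y ∧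
      (∀ ξ, (∫⁻ x in {x : S2 | ⟪e x, ξ⟫ = 0} ∩ chartR R '' Dsq, g x ∂(μH[1] : Measure S2)) ^ 2
        ≤ Y ξ) ∧
      ∫⁻ ξ, Y ξ ∂(stdGaussian (EuclideanSpace ℝ (Fin m))) ≤
        CP * ((n : ℝ≥0∞) ^ 2 * (∫⁻ x, g x ∂sphArea) ^ 2 + M * ∫⁻ x, g x ∂sphArea) := by
  have hE := En_ge_two hn
  set G : ℝ × ℝ → EuclideanSpace ℝ (Fin m) := fun u => e (R (chart0 u)) with hG
  have hGi (u v : ℝ × ℝ) : ⟪G u, G v⟫ = Pl n ⟪chart0 u, chart0 v⟫ := by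
    have := hP (chartR R u) (chartR R v)
    rwa [inner_chartR] at this
  have hGn (u : ℝ × ℝ) : ‖G u‖ = 1 := by
    have h := hGi u u
    rw [real_inner_self_eq_norm_sq, real_inner_self_eq_norm_sq, norm_chart0, one_pow, Pl_one] at h
    exact (pow_eq_one_iff_of_nonneg (norm_nonneg _) two_ne_zero).1 h
  have hGc : ContDiff ℝ 2 G :=
    he.comp ((R.toContinuousLinearEquiv.contDiff (n := 2)).comp contDiff_chart0)
  have hΛs : √(6 * En n) ^ 2 = 6 * En n := Real.sq_sqrt (by linarith)
  obtain ⟨Y, hYm, hY1, hY2⟩ := core hGc (Λ := √(6 * En n)) (s := 1/30)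
    (Real.sqrt_pos.2 (by linarith)) (by norm_num) (fun u _ => hGn u)
    (fun u hu v hv => by
      refine (sq_le_sq₀ (norm_nonneg _) (by positivity)).1 ?_
      obtain ⟨c0, c1, -, c3⟩ := chart0_c hu hv
      have h1 := one_sub_Pl_le hn ⟨c0, c1⟩
      rw [norm_sub_sq_real, hGn, hGn, hGi, mul_pow, hΛs]
      have h2 := mul_le_mul_of_nonneg_left c3 (show 0 ≤ En n by linarith)
      linarith)
    (fun u hu v hv => by
      obtain ⟨c0, c1, c2, -⟩ := chart0_c hu hv
      have h1 := one_sub_Pl_sq_ge hn ⟨c0, c1⟩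
      rw [hGi, hΛs]
      refine le_trans ?_ h1
      have h2 := mul_le_mul_of_nonneg_left c2 (show 0 ≤ En n by linarith)
      have hd := mul_nonneg (show 0 ≤ En n by linarith) (sq_nonneg (dist u v))
      rcases min_cases 1 (En n * (1 - ⟪chart0 u, chart0 v⟫)) with ⟨h, -⟩ | ⟨h, -⟩ <;> rw [h]
      · have := min_le_left 1 (6 * En n * dist u v ^ 2)
        linarith
      · have := min_le_right 1 (6 * En n * dist u v ^ 2)
        linarith)
    (h := fun u => g (chartR R u)) (hg.comp (continuous_chartR R).measurable) hMt (fun u => hM _)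
  refine ⟨fun ξ => 9 * Y ξ, hYm.const_mul _, fun ξ => ?_, ?_⟩
  · have hZ : MeasurableSet {x : S2 | ⟪e x, ξ⟫ = 0} := by
      refine IsClosed.measurableSet (isClosed_eq ?_ continuous_const)
      have := he.continuous
      fun_prop
    refine (pow_le_pow_left' (transfer1_lint R hZ hg) 2).trans ?_
    rw [mul_pow]
    refine mul_le_mul' (by norm_num) (hY1 ξ)
  · rw [lintegral_const_mul _ hYm, CP, mul_assoc]
    refine mul_le_mul' le_rfl (hY2.trans ?_)
    rw [mul_assoc]
    refine mul_le_mul' le_rfl ?_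
    have h1 : ENNReal.ofReal (√(6 * En n) ^ 2) ≤ 12 * (n : ℝ≥0∞)^2 := by
      have hn' : (1:ℝ) ≤ n := by exact_mod_cast hn
      have : √(6 * En n) ^ 2 ≤ ((12 * n^2 : ℕ) : ℝ) := by
        rw [hΛs, En]; push_cast; nlinarith
      refine (ENNReal.ofReal_le_ofReal this).trans ?_
      rw [ENNReal.ofReal_natCast]; push_cast; exact le_rfl
    have h2 := transfer2_lint R hg
    calc _ ≤ 12 * (n : ℝ≥0∞)^2 * (4 * ∫⁻ x, g x ∂sphArea)^2 + M * (4 * ∫⁻ x, g x ∂sphArea) := by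
          gcongr
      _ = 192 * ((n : ℝ≥0∞)^2 * (∫⁻ x, g x ∂sphArea)^2) + 4 * (M * ∫⁻ x, g x ∂sphArea) := by ring
      _ ≤ 192 * ((n : ℝ≥0∞)^2 * (∫⁻ x, g x ∂sphArea)^2) + 192 * (M * ∫⁻ x, g x ∂sphArea) := by
          gcongr; norm_num
      _ = _ := by ring

/-! ### Assembly -/

lemma sum_patch_sq {ι : Type*} (T : Finset ι) (a : ι → ℝ≥0∞) :
    (∑ i ∈ T, a i) ^ 2 ≤ (T.card : ℝ≥0∞) ^ 2 * ∑ i ∈ T, a i ^ 2 := by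
  have h : ∑ i ∈ T, a i ≤ T.card * T.sup a := by
    refine (Finset.sum_le_card_nsmul T a (T.sup a) fun i hi => Finset.le_sup hi).trans ?_
    rw [nsmul_eq_mul]
  refine (pow_le_pow_left' h 2).trans ?_
  rw [mul_pow]
  refine mul_le_mul' le_rfl ?_
  rcases T.eq_empty_or_nonempty with rfl | hT
  · simp
  · obtain ⟨i, hi, hs⟩ := Finset.exists_mem_eq_sup T hT a
    rw [hs]
    exact Finset.single_le_sum (f := fun i => a i ^ 2) (fun _ _ => zero_le) hi

lemma lintegral_bound : ∃ K : ℝ≥0∞, K ≠ ⊤ ∧ ∀ {Ω : Type} [MeasureSpace Ω] (n : ℕ) (f : Ω → S2 → ℝ),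
    IsRandomSphericalHarmonic n f → ∀ (g : S2 → ℝ≥0∞), Measurable g → ∀ M : ℝ≥0∞, M ≠ ⊤ →
    (∀ x, g x ≤ M) →
    ∫⁻ ω, (∫⁻ x in {x : S2 | f ω x = 0}, g x ∂(μH[1] : Measure S2)) ^ 2 ≤
      K * ((n : ℝ≥0∞) ^ 2 * (∫⁻ x, g x ∂sphArea) ^ 2 + M * ∫⁻ x, g x ∂sphArea) := by
  classical
  obtain ⟨T, hT⟩ := exists_cover
  refine ⟨(T.card : ℝ≥0∞) ^ 2 * (T.card * CP), ENNReal.mul_ne_top (by finiteness)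
    (ENNReal.mul_ne_top (by finiteness) CP_ne_top), ?_⟩
  intro Ω _ n f hf g hg M hMt hM
  obtain ⟨m, e, ξ, he, hP, hξ, hlaw, hae⟩ := rsh_repr hf
  rcases Nat.eq_zero_or_pos n with rfl | hn
  · -- degree zero: the field is a.s. a nonzero constant
    have hP0 : ∀ t, Pl 0 t = 1 := fun t => by simp [Pl, legendreP]
    let p : S2 := chartR (LinearIsometryEquiv.refl ℝ E3) 0
    have hn1 (x : S2) : ‖e x‖ = 1 := by
      have h := hP x x
      rw [real_inner_self_eq_norm_sq, hP0] at h
      exact (pow_eq_one_iff_of_nonneg (norm_nonneg _) two_ne_zero).1 h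
    have hconst (x : S2) : e x = e p := by
      have h : ⟪e x, e p⟫ = 1 := by rw [hP, hP0]
      exact (inner_eq_one_iff_of_norm_eq_one (hn1 x) (hn1 p)).1 h
    have hz : stdGaussian (EuclideanSpace ℝ (Fin m)) {v | ⟪e p, v⟫ = 0} = 0 := by
      have h := one_point (0 : Seminorm ℝ (EuclideanSpace ℝ (Fin m))) continuous_const
        (B := 1) (ε := 0) one_pos le_rfl (fun v => by simp) (by simp) (hn1 p) (by simp)
      simpa using h
    have hz' : ∀ᵐ ω, ⟪e p, ξ ω⟫ ≠ 0 := by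
      rw [← hlaw] at hz
      have hz2 : ∀ᵐ v ∂(Measure.map ξ volume), ⟪e p, v⟫ ≠ 0 := by
        rw [ae_iff]; simpa using hz
      exact ae_of_ae_map hξ hz2
    have : ∫⁻ ω, (∫⁻ x in {x : S2 | f ω x = 0}, g x ∂(μH[1] : Measure S2)) ^ 2
        = ∫⁻ ω : Ω, 0 := by
      refine lintegral_congr_ae ?_
      filter_upwards [hae, hz'] with ω h1 h2
      have hem : {x : S2 | f ω x = 0} = ∅ := by
        ext x
        simp only [Set.mem_ofPred_eq, Set.mem_empty_iff_false, iff_false, h1 x, hconst x]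
        exact h2
      rw [hem]; simp
    rw [this]; simp
  · choose Y hYm hY1 hY2 using fun R : E3 ≃ₗᵢ[ℝ] E3 => patch_bound hn he hP R hg hMt hM
    have key : ∀ᵐ ω, (∫⁻ x in {x : S2 | f ω x = 0}, g x ∂(μH[1] : Measure S2)) ^ 2 ≤
        (T.card : ℝ≥0∞) ^ 2 * ∑ R ∈ T, Y R (ξ ω) := by
      filter_upwards [hae] with ω hω
      have hset : {x : S2 | f ω x = 0} ⊆ ⋃ R ∈ T, {x : S2 | ⟪e x, ξ ω⟫ = 0} ∩ chartR R '' Dsq := by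
        intro x hx
        obtain ⟨R, hR, u, hu, hux⟩ := hT x
        refine Set.mem_biUnion hR ⟨?_, u, hu, hux⟩
        change ⟪e x, ξ ω⟫ = 0
        rw [← hω x]; exact hx
      have h1 : ∫⁻ x in {x : S2 | f ω x = 0}, g x ∂(μH[1] : Measure S2) ≤
          ∑ R ∈ T, ∫⁻ x in {x : S2 | ⟪e x, ξ ω⟫ = 0} ∩ chartR R '' Dsq, g x ∂(μH[1] : Measure S2) := by
        refine (lintegral_mono_set hset).trans ?_
        refine (lintegral_mono' (Measure.restrict_biUnion_le T.countable_toSet) le_rfl).trans ?_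
        rw [lintegral_sum_measure]
        rw [← Finset.tsum_subtype T (fun R => ∫⁻ x in {x : S2 | ⟪e x, ξ ω⟫ = 0} ∩ chartR R '' Dsq, g x ∂(μH[1] : Measure S2))]
        exact le_rfl
      refine (pow_le_pow_left' h1 2).trans ((sum_patch_sq T _).trans ?_)
      gcongr with R hR
      exact hY1 R _
    refine (lintegral_mono_ae key).trans ?_
    have hm : Measurable fun v => ∑ R ∈ T, Y R v := Finset.measurable_sum _ fun R _ => hYm R
    have hmξ : AEMeasurable (fun ω => ∑ R ∈ T, Y R (ξ ω)) := hm.comp_aemeasurable hξ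
    rw [lintegral_const_mul'' _ hmξ, mul_assoc, mul_assoc]
    refine mul_le_mul' le_rfl ?_
    have h2 := lintegral_map' (μ := (volume : Measure Ω)) (hm.aemeasurable) hξ
    rw [← h2, hlaw, lintegral_finsetSum _ fun R _ => hYm R]
    refine (Finset.sum_le_card_nsmul T _ _ fun R _ => hY2 R).trans ?_
    rw [nsmul_eq_mul]

lemma real_bound {Ω : Type} [MeasureSpace Ω] {K : ℝ≥0∞} (hK : K ≠ ⊤) {n : ℕ} {W : Ω → ℝ}
    {L : Ω → ℝ≥0∞} (hW : ∀ ω, ENNReal.ofReal |W ω| ≤ L ω) {I m : ℝ} (hI : 0 ≤ I) (hm : 0 ≤ m)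
    (h : ∫⁻ ω, L ω ^ 2 ≤ K * ((n : ℝ≥0∞) ^ 2 * ENNReal.ofReal I ^ 2
      + ENNReal.ofReal m * ENNReal.ofReal I)) :
    ∫ ω, W ω ^ 2 ≤ K.toReal * ((n : ℝ) ^ 2 * I ^ 2 + m * I) := by
  have hr : K * ((n : ℝ≥0∞) ^ 2 * ENNReal.ofReal I ^ 2 + ENNReal.ofReal m * ENNReal.ofReal I)
      = ENNReal.ofReal (K.toReal * ((n : ℝ) ^ 2 * I ^ 2 + m * I)) := by
    rw [ENNReal.ofReal_mul ENNReal.toReal_nonneg, ENNReal.ofReal_toReal hK,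
      ENNReal.ofReal_add (by positivity) (by positivity), ENNReal.ofReal_mul (by positivity),
      ENNReal.ofReal_mul hm, ENNReal.ofReal_pow hI, ENNReal.ofReal_pow (Nat.cast_nonneg n),
      ENNReal.ofReal_natCast]
  have hnn : 0 ≤ K.toReal * ((n : ℝ) ^ 2 * I ^ 2 + m * I) := by positivity
  by_cases hinteg : Integrable (fun ω => W ω ^ 2)
  · rw [integral_eq_lintegral_of_nonneg_ae (Eventually.of_forall fun ω => sq_nonneg _)
      hinteg.aestronglyMeasurable]
    refine ENNReal.toReal_le_of_le_ofReal hnn ?_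
    rw [← hr]
    refine (lintegral_mono fun ω => ?_).trans h
    rw [← sq_abs, ENNReal.ofReal_pow (abs_nonneg _)]
    exact pow_le_pow_left' (hW ω) 2
  · rw [integral_undef hinteg]; exact hnn

lemma exists_majorant {φ : S2 → ℝ} (hφ : Integrable φ sphArea) {m : ℝ} (hm : ∀ x, |φ x| ≤ m) :
    ∃ g : S2 → ℝ≥0∞, Measurable g ∧ (∀ x, g x ≤ ENNReal.ofReal m) ∧
      (∀ x, ENNReal.ofReal |φ x| ≤ g x) ∧
      ∫⁻ x, g x ∂sphArea = ENNReal.ofReal (∫ x, |φ x| ∂sphArea) := by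
  classical
  have hae := hφ.1.ae_eq_mk
  set ψ := hφ.1.mk φ
  have hψ : Measurable ψ := hφ.1.stronglyMeasurable_mk.measurable
  set N := toMeasurable sphArea {x | φ x ≠ ψ x}
  have hN : MeasurableSet N := measurableSet_toMeasurable _ _
  have hN0 : sphArea N = 0 := by
    rw [measure_toMeasurable]; exact hae
  have hoff : ∀ x, x ∉ N → φ x = ψ x := fun x hx => by
    by_contra h
    exact hx (subset_toMeasurable _ _ h)
  refine ⟨N.piecewise (fun _ => ENNReal.ofReal m) (fun x => ENNReal.ofReal |ψ x|),
    Measurable.piecewise hN measurable_const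
      (ENNReal.measurable_ofReal.comp (continuous_abs.measurable.comp hψ)), fun x => ?_, fun x => ?_, ?_⟩
  · by_cases hx : x ∈ N
    · simp [hx]
    · rw [Set.piecewise_eq_of_notMem _ _ _ hx, ← hoff x hx]
      exact ENNReal.ofReal_le_ofReal (hm x)
  · by_cases hx : x ∈ N
    · rw [Set.piecewise_eq_of_mem _ _ _ hx]
      exact ENNReal.ofReal_le_ofReal (hm x)
    · rw [Set.piecewise_eq_of_notMem _ _ _ hx, ← hoff x hx]
  · rw [ofReal_integral_eq_lintegral_ofReal hφ.abs (Eventually.of_forall fun x => abs_nonneg _)]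
    refine lintegral_congr_ae ?_
    have : ∀ᵐ x ∂sphArea, x ∉ N := measure_eq_zero_iff_ae_notMem.1 hN0
    filter_upwards [this] with x hx
    rw [Set.piecewise_eq_of_notMem _ _ _ hx, ← hoff x hx]

/-- **Continuity of the distribution of `Z^φ`** (Proposition 5.2). There is a universal
constant `c` such that for every `φ ∈ BV(S²) ∩ L^∞(S²)`, the second moment of the linear
statistic satisfies `E[Z^φ(f_n)²] ≤ c (n² ‖φ‖²_{L¹(S²)} + ‖φ‖_∞ ‖φ‖_{L¹(S²)})`; in
particular, if `F ⊆ S²` has `C²` boundary then `E[Z^F(f_n)²] ≤ c (n² |F|² + |F|)`. -/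
theorem second_moment_nodalStat_bound :
    ∃ c : ℝ,
      (∀ {Ω : Type} [MeasureSpace Ω] (n : ℕ) (f : Ω → S2 → ℝ),
        IsRandomSphericalHarmonic n f →
        ∀ φ : S2 → ℝ, IsBV φ → (∃ M : ℝ, ∀ x : S2, |φ x| ≤ M) →
          (∫ ω, (nodalStat φ (f ω)) ^ 2) ≤
            c * ((n : ℝ) ^ 2 * (∫ x, |φ x| ∂sphArea) ^ 2
              + (⨆ x : S2, |φ x|) * ∫ x, |φ x| ∂sphArea)) ∧
      (∀ {Ω : Type} [MeasureSpace Ω] (n : ℕ) (f : Ω → S2 → ℝ),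
        IsRandomSphericalHarmonic n f →
        ∀ F : Set S2, IsC2Domain F →
          (∫ ω, (nodalLengthIn F (f ω)) ^ 2) ≤
            c * ((n : ℝ) ^ 2 * ((sphArea F).toReal) ^ 2 + (sphArea F).toReal)) := by

  obtain ⟨K, hK, hb⟩ := lintegral_bound
  refine ⟨K.toReal, ?_, ?_⟩
  · intro Ω _ n f hf φ hφ hbd
    have hbdd : BddAbove (Set.range fun x : S2 => |φ x|) := by
      obtain ⟨M, hM⟩ := hbd
      exact ⟨M, by rintro _ ⟨x, rfl⟩; exact hM x⟩
    obtain ⟨g, hg, hgm, hgφ, hgI⟩ := exists_majorant hφ.1 (m := ⨆ x : S2, |φ x|)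
      (fun x => le_ciSup hbdd x)
    have h := hb n f hf g hg _ ENNReal.ofReal_ne_top hgm
    rw [hgI] at h
    refine real_bound hK (L := fun ω => ∫⁻ x in {x : S2 | f ω x = 0}, g x ∂(μH[1] : Measure S2))
      (fun ω => ?_) (integral_nonneg fun x => abs_nonneg _) (Real.iSup_nonneg fun x => abs_nonneg _) h
    rw [← Real.enorm_eq_ofReal_abs, nodalStat]
    refine (enorm_integral_le_lintegral_enorm _).trans (lintegral_mono fun x => ?_)
    rw [Real.enorm_eq_ofReal_abs]
    exact hgφ x
  · intro Ω _ n f hf F hF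
    have hFm : MeasurableSet F := by
      obtain ⟨Φ, hΦ, hF, -⟩ := hF
      have : F = {x : S2 | Φ x ≤ 0} := Set.ext hF
      rw [this]
      exact (isClosed_le (hΦ.continuous.comp continuous_subtype_val) continuous_const).measurableSet
    have h := hb n f hf (F.indicator 1) (measurable_one.indicator hFm) 1 ENNReal.one_ne_top
      (fun x => Set.indicator_le_self' (fun _ _ => zero_le) x)
    rw [lintegral_indicator_one hFm, ← ENNReal.ofReal_toReal (measure_ne_top sphArea F),
      ← ENNReal.ofReal_one] at h
    have := real_bound hK (W := fun ω => nodalLengthIn F (f ω))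
      (L := fun ω => ∫⁻ x in {x : S2 | f ω x = 0}, F.indicator 1 x ∂(μH[1] : Measure S2))
      (fun ω => ?_) ENNReal.toReal_nonneg zero_le_one h
    · simpa using this
    · rw [lintegral_indicator_one hFm, Measure.restrict_apply hFm, nodalLengthIn, Set.inter_comm,
        abs_of_nonneg ENNReal.toReal_nonneg]
      exact ENNReal.ofReal_toReal_le
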